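/- arXiv:math/0210252 — 4 statements merged into one kernel-verified Lean document; each statement's English description precedes it below -/
import Mathlib

section
/- Let μ be a Borel probability measure on the set GL⁻(2,ℝ) of 2×2 real matrices with negative determinant, such that A ↦ log⁺‖A‖_op and A ↦ log⁺‖A⁻¹‖_op are μ-integrable, such that μ is SO(2)-invariant (for every rotation matrix O ∈ SO(2), the pushforward of μ under A ↦ O·A equals μ), and such that the support of μ is not contained in ℝ·O(2) = { c·Q : c ∈ ℝ, Q a 2×2 orthogonal matrix }. Then ∫ log ρ(A) dμ(A) > ∫ ( (1/(2π)) ∫₀^{2π} log ‖A·u(θ)‖ dθ ) dμ(A), where ρ(A) denotes the spectral radius of A and u(θ) = (cos θ, sin θ). -/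
open MeasureTheory

noncomputable instance : MeasurableSpace (Matrix (Fin 2) (Fin 2) ℝ) := borel _
instance : BorelSpace (Matrix (Fin 2) (Fin 2) ℝ) := ⟨rfl⟩

/-- The unit vector `(cos θ, sin θ)` in `ℝ²`. -/
noncomputable def unitVec (θ : ℝ) : Fin 2 → ℝ := ![Real.cos θ, Real.sin θ]

/-- Regard a pair of reals as a vector of the Euclidean plane (with the Euclidean norm). -/
noncomputable def toE2 (v : Fin 2 → ℝ) : EuclideanSpace ℝ (Fin 2) :=
  (WithLp.equiv 2 (Fin 2 → ℝ)).symm v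

/-- The operator norm of a 2×2 real matrix acting on `ℝ²` with the Euclidean norm. -/
noncomputable def opNormR (A : Matrix (Fin 2) (Fin 2) ℝ) : ℝ :=
  ‖Matrix.toEuclideanCLM (𝕜 := ℝ) A‖

/-- The spectral radius of a 2×2 real matrix: the maximum modulus of its complex
eigenvalues. -/
noncomputable def specRadR (A : Matrix (Fin 2) (Fin 2) ℝ) : ℝ :=
  (spectralRadius ℂ (A.map Complex.ofReal)).toReal

/-- The rotation matrix by angle `φ`. -/
noncomputable def rotMat (φ : ℝ) : Matrix (Fin 2) (Fin 2) ℝ :=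
  !![Real.cos φ, -Real.sin φ; Real.sin φ, Real.cos φ]

/-- The set `ℝ·O(2)` of real scalar multiples of 2×2 orthogonal matrices. -/
def scalarO2 : Set (Matrix (Fin 2) (Fin 2) ℝ) :=
  {A | ∃ c : ℝ, ∃ Q : Matrix (Fin 2) (Fin 2) ℝ, Q.transpose * Q = 1 ∧ A = c • Q}


/-- The half-period integral of `arsinh (t cos φ)`. -/
noncomputable def Hfun (t : ℝ) : ℝ :=
  ∫ φ in (-(Real.pi / 2))..(Real.pi / 2), Real.arsinh (t * Real.cos φ)

lemma Hfun_hasDerivAt (t : ℝ) :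
    HasDerivAt Hfun (∫ φ in (-(Real.pi / 2))..(Real.pi / 2),
      (√(1 + (t * Real.cos φ) ^ 2))⁻¹ * Real.cos φ) t := by
  have hpos : ∀ x φ : ℝ, 0 < √(1 + (x * Real.cos φ) ^ 2) := fun x φ => by positivity
  have := intervalIntegral.hasDerivAt_integral_of_dominated_loc_of_deriv_le
    (μ := volume) (a := -(Real.pi / 2)) (b := Real.pi / 2)
    (F := fun t φ => Real.arsinh (t * Real.cos φ))
    (F' := fun t φ => (√(1 + (t * Real.cos φ) ^ 2))⁻¹ * Real.cos φ)
    (x₀ := t) (s := Set.univ) (bound := fun _ => 1) Filter.univ_mem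
    (Filter.Eventually.of_forall fun x => by
      have : Continuous (fun φ => Real.arsinh (x * Real.cos φ)) := by
        exact Continuous.arsinh (by fun_prop)
      exact this.aestronglyMeasurable)
    (by
      have : Continuous (fun φ => Real.arsinh (t * Real.cos φ)) := by
        exact Continuous.arsinh (by fun_prop)
      exact this.intervalIntegrable _ _)
    (by
      have : Continuous (fun φ => (√(1 + (t * Real.cos φ) ^ 2))⁻¹ * Real.cos φ) := by
        refine Continuous.mul (Continuous.inv₀ (by fun_prop) fun φ => (hpos t φ).ne') (by fun_prop)
      exact this.aestronglyMeasurable)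
    (by
      refine Filter.Eventually.of_forall fun φ _ x _ => ?_
      rw [norm_mul, norm_inv, Real.norm_of_nonneg (hpos x φ).le]
      have h1 : 1 ≤ √(1 + (x * Real.cos φ) ^ 2) := by
        rw [Real.one_le_sqrt]; nlinarith [sq_nonneg (x * Real.cos φ)]
      have h2 : (√(1 + (x * Real.cos φ) ^ 2))⁻¹ ≤ 1 := inv_le_one_of_one_le₀ h1
      have h3 : ‖Real.cos φ‖ ≤ 1 := Real.abs_cos_le_one φ
      have h4 : 0 ≤ ‖Real.cos φ‖ := norm_nonneg _
      have h5 : 0 ≤ (√(1 + (x * Real.cos φ) ^ 2))⁻¹ := by positivity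
      nlinarith)
    (by simp)
    (by
      refine Filter.Eventually.of_forall fun φ _ x _ => ?_
      have : HasDerivAt (fun x => x * Real.cos φ) (Real.cos φ) x := by
        simpa using (hasDerivAt_id x).mul_const (Real.cos φ)
      simpa using this.arsinh)
  exact this.2

lemma Hderiv_eq {t : ℝ} (ht : 0 < t) :
    (∫ φ in (-(Real.pi / 2))..(Real.pi / 2),
      (√(1 + (t * Real.cos φ) ^ 2))⁻¹ * Real.cos φ) = 2 * Real.arctan t / t := by
  have hT : 0 < √(1 + t ^ 2) := by positivity
  have hT2 : √(1 + t ^ 2) ^ 2 = 1 + t ^ 2 := Real.sq_sqrt (by positivity)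
  have key : ∀ φ : ℝ, HasDerivAt
      (fun φ => Real.arcsin (t * Real.sin φ / √(1 + t ^ 2)) / t)
      ((√(1 + (t * Real.cos φ) ^ 2))⁻¹ * Real.cos φ) φ := by
    intro φ
    have hsq : 1 - (t * Real.sin φ / √(1 + t ^ 2)) ^ 2
        = (1 + (t * Real.cos φ) ^ 2) / (1 + t ^ 2) := by
      rw [div_pow, hT2]
      field_simp
      nlinarith [Real.sin_sq_add_cos_sq φ]
    have hlt : 0 < 1 - (t * Real.sin φ / √(1 + t ^ 2)) ^ 2 := by
      rw [hsq]; positivity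
    have h1 : t * Real.sin φ / √(1 + t ^ 2) ≠ -1 := by
      intro h; rw [h] at hlt; norm_num at hlt
    have h2 : t * Real.sin φ / √(1 + t ^ 2) ≠ 1 := by
      intro h; rw [h] at hlt; norm_num at hlt
    have hd : HasDerivAt (fun φ => t * Real.sin φ / √(1 + t ^ 2))
        (t * Real.cos φ / √(1 + t ^ 2)) φ :=
      ((Real.hasDerivAt_sin φ).const_mul t).div_const _
    have h3 := ((Real.hasDerivAt_arcsin h1 h2).comp φ hd).div_const t
    refine h3.congr_deriv ?_
    rw [hsq, Real.sqrt_div (by positivity)]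
    have : 0 < √(1 + (t * Real.cos φ) ^ 2) := by positivity
    field_simp
  have hcont : Continuous (fun φ => (√(1 + (t * Real.cos φ) ^ 2))⁻¹ * Real.cos φ) := by
    refine Continuous.mul (Continuous.inv₀ (by fun_prop) fun φ => ?_) (by fun_prop)
    positivity
  rw [intervalIntegral.integral_eq_sub_of_hasDerivAt (fun φ _ => key φ)
    (hcont.intervalIntegrable _ _)]
  rw [Real.sin_neg, Real.sin_pi_div_two, mul_neg, neg_div, Real.arcsin_neg, mul_one,
    ← Real.arctan_eq_arcsin]
  ring

/-- The difference whose positivity we need. -/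
noncomputable def Dfun (t : ℝ) : ℝ := Hfun t - Real.pi / 2 * Real.log (1 + t ^ 2)

lemma Dfun_hasDerivAt {t : ℝ} (ht : 0 < t) :
    HasDerivAt Dfun (2 * Real.arctan t / t - Real.pi * t / (1 + t ^ 2)) t := by
  have h1 := Hfun_hasDerivAt t
  rw [Hderiv_eq ht] at h1
  have h2 : HasDerivAt (fun t : ℝ => 1 + t ^ 2) (2 * t) t := by
    simpa using (hasDerivAt_pow 2 t).const_add 1
  have h3 := (h2.log (by positivity)).const_mul (Real.pi / 2)
  have h4 := h1.sub h3
  refine h4.congr_deriv ?_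
  ring

lemma Dfun_zero : Dfun 0 = 0 := by simp [Dfun, Hfun]

lemma Dfun_continuous : Continuous Dfun := by
  have h1 : Continuous Hfun :=
    continuous_iff_continuousAt.2 fun t => (Hfun_hasDerivAt t).continuousAt
  refine h1.sub (continuous_const.mul (Continuous.log (by fun_prop) fun t => ?_))
  positivity

lemma Dderiv_pos {t : ℝ} (ht : 0 < t) (ht1 : t < 1) :
    0 < 2 * Real.arctan t / t - Real.pi * t / (1 + t ^ 2) := by
  have ha0 : 0 < Real.arctan t := Real.arctan_pos.2 ht
  have ha1 : Real.arctan t < Real.pi / 4 := by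
    rw [← Real.arctan_one]; exact Real.arctan_strictMono ht1
  have h := Real.mul_lt_sin (x := Real.pi / 2 - 2 * Real.arctan t) (by linarith) (by linarith)
  rw [Real.sin_pi_div_two_sub, Real.cos_two_mul, Real.cos_sq_arctan] at h
  have hpi := Real.pi_pos
  have e1 : 2 / Real.pi * (Real.pi / 2 - 2 * Real.arctan t)
    = 1 - 4 * Real.arctan t / Real.pi := by field_simp; ring
  rw [e1] at h
  have h5 : 1 - 1 / (1 + t ^ 2) < 2 * Real.arctan t / Real.pi := by
    have : 4 * Real.arctan t / Real.pi = 2 * (2 * Real.arctan t / Real.pi) := by ring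
    linarith
  have e2 : 1 - 1 / (1 + t ^ 2) = t ^ 2 / (1 + t ^ 2) := by field_simp; ring
  rw [e2, lt_div_iff₀ hpi] at h5
  have e3 : 2 * Real.arctan t / t - Real.pi * t / (1 + t ^ 2)
    = (2 * Real.arctan t - t ^ 2 / (1 + t ^ 2) * Real.pi) / t := by field_simp
  rw [e3]
  exact div_pos (by linarith) ht

lemma Dfun_pos_of_le_one {t : ℝ} (ht : 0 < t) (ht1 : t ≤ 1) : 0 < Dfun t := by
  have hm : StrictMonoOn Dfun (Set.Icc 0 1) := by
    refine strictMonoOn_of_deriv_pos (convex_Icc _ _) Dfun_continuous.continuousOn ?_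
    intro x hx
    rw [interior_Icc] at hx
    rw [(Dfun_hasDerivAt hx.1).deriv]
    exact Dderiv_pos hx.1 hx.2
  have := hm (a := 0) (b := t) (by simp) ⟨ht.le, ht1⟩ ht
  rwa [Dfun_zero] at this

lemma Dfun_inv {t : ℝ} (ht : 0 < t) : Dfun t = Dfun t⁻¹ := by
  have hd : ∀ x ∈ Set.Ioi (0 : ℝ), HasDerivAt (fun x => Dfun x - Dfun x⁻¹) 0 x := by
    intro x hx
    have hx : 0 < x := hx
    have h1 := (Dfun_hasDerivAt hx).sub
      ((Dfun_hasDerivAt (inv_pos.2 hx)).comp x (hasDerivAt_inv hx.ne'))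
    refine h1.congr_deriv ?_
    rw [Real.arctan_inv_of_pos hx]
    field_simp
    ring
  have hc : ∀ x ∈ Set.Ioi (0 : ℝ), ∀ y ∈ Set.Ioi (0 : ℝ),
      Dfun x - Dfun x⁻¹ = Dfun y - Dfun y⁻¹ := by
    intro x hx y hy
    refine IsOpen.is_const_of_deriv_eq_zero isOpen_Ioi (convex_Ioi (0:ℝ)).isPreconnected
      (f := fun x => Dfun x - Dfun x⁻¹) ?_ ?_ hx hy
    · exact fun z hz => (hd z hz).differentiableAt.differentiableWithinAt
    · exact fun z hz => (hd z hz).deriv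
  have := hc t ht 1 (by simp)
  rw [inv_one] at this
  linarith

lemma Dfun_pos {t : ℝ} (ht : 0 < t) : 0 < Dfun t := by
  rcases le_total t 1 with h | h
  · exact Dfun_pos_of_le_one ht h
  · rw [Dfun_inv ht]
    exact Dfun_pos_of_le_one (inv_pos.2 ht) (inv_le_one_of_one_le₀ h)

/-- The full-period average with a phase. -/
lemma integral_arsinh_abs_cos (t α : ℝ) :
    ∫ φ in (0:ℝ)..(2 * Real.pi), Real.arsinh (t * |Real.cos (φ + α)|) = 2 * Hfun t := by
  have hcont : Continuous (fun φ => Real.arsinh (t * |Real.cos φ|)) :=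
    Continuous.arsinh (by fun_prop)
  have hper : Function.Periodic (fun φ => Real.arsinh (t * |Real.cos φ|)) Real.pi := by
    intro φ
    simp [Real.cos_add_pi]
  have h1 : ∫ φ in (0:ℝ)..(2 * Real.pi), Real.arsinh (t * |Real.cos (φ + α)|)
      = ∫ φ in (0 + α)..(2 * Real.pi + α), Real.arsinh (t * |Real.cos φ|) :=
    intervalIntegral.integral_comp_add_right (fun φ => Real.arsinh (t * |Real.cos φ|)) α
  have hH : Hfun t = ∫ φ in (-(Real.pi/2))..(-(Real.pi / 2) + Real.pi),
      Real.arsinh (t * |Real.cos φ|) := by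
    have : -(Real.pi / 2) + Real.pi = Real.pi / 2 := by ring
    rw [this]
    unfold Hfun
    refine intervalIntegral.integral_congr fun φ hφ => ?_
    rw [Set.uIcc_of_le (by linarith [Real.pi_pos])] at hφ
    rw [abs_of_nonneg (Real.cos_nonneg_of_mem_Icc hφ)]
  rw [h1, ← intervalIntegral.integral_add_adjacent_intervals (b := α + Real.pi)
    (hcont.intervalIntegrable _ _) (hcont.intervalIntegrable _ _), hH, zero_add,
    show 2 * Real.pi + α = (α + Real.pi) + Real.pi by ring,
    hper.intervalIntegral_add_eq α (-(Real.pi/2)),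
    hper.intervalIntegral_add_eq (α + Real.pi) (-(Real.pi/2))]
  ring

/-- Half the trace. -/
noncomputable def htr (A : Matrix (Fin 2) (Fin 2) ℝ) : ℝ := (A 0 0 + A 1 1) / 2

/-- Squared modulus of the conformal part. -/
noncomputable def naM (A : Matrix (Fin 2) (Fin 2) ℝ) : ℝ :=
  ((A 0 0 + A 1 1) ^ 2 + (A 1 0 - A 0 1) ^ 2) / 4

/-- Squared modulus of the anticonformal part. -/
noncomputable def nbM (A : Matrix (Fin 2) (Fin 2) ℝ) : ℝ :=
  ((A 0 0 - A 1 1) ^ 2 + (A 1 0 + A 0 1) ^ 2) / 4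

/-- Explicit spectral radius for negative determinant. -/
noncomputable def rhoM (A : Matrix (Fin 2) (Fin 2) ℝ) : ℝ :=
  |htr A| + √(htr A ^ 2 + (-A.det))

lemma nb_eq (A : Matrix (Fin 2) (Fin 2) ℝ) : nbM A = naM A + (-A.det) := by
  rw [Matrix.det_fin_two]; unfold nbM naM; ring

lemma na_nonneg (A : Matrix (Fin 2) (Fin 2) ℝ) : 0 ≤ naM A := by unfold naM; positivity

lemma htr_sq_le (A : Matrix (Fin 2) (Fin 2) ℝ) : htr A ^ 2 ≤ naM A := by
  unfold naM htr; nlinarith [sq_nonneg (A 1 0 - A 0 1)]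

lemma specRad_eq {A : Matrix (Fin 2) (Fin 2) ℝ} (hA : A.det < 0) : specRadR A = rhoM A := by
  set x := htr A with hx
  set q := √(htr A ^ 2 + (-A.det)) with hq
  have hq2 : q ^ 2 = x ^ 2 + (-A.det) := Real.sq_sqrt (by nlinarith [sq_nonneg x])
  have hq0 : 0 ≤ q := Real.sqrt_nonneg _
  have hspec : ∀ k : ℂ, k ∈ spectrum ℂ (A.map Complex.ofReal) ↔
      k = ((x + q : ℝ) : ℂ) ∨ k = ((x - q : ℝ) : ℂ) := by
    intro k
    rw [spectrum.mem_iff, Matrix.isUnit_iff_isUnit_det, isUnit_iff_ne_zero, not_not]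
    have e : (algebraMap ℂ (Matrix (Fin 2) (Fin 2) ℂ) k - A.map Complex.ofReal).det
        = (k - ((x + q : ℝ) : ℂ)) * (k - ((x - q : ℝ) : ℂ)) := by
      have e1 : (k - ((x + q : ℝ) : ℂ)) * (k - ((x - q : ℝ) : ℂ))
        = k ^ 2 - 2 * x * k + ((x ^ 2 - q ^ 2 : ℝ) : ℂ) := by push_cast; ring
      have e2 : x ^ 2 - q ^ 2 = A 0 0 * A 1 1 - A 0 1 * A 1 0 := by
        rw [hq2, Matrix.det_fin_two]; ring
      have e3 : 2 * (x : ℂ) = A 0 0 + A 1 1 := by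
        rw [hx]; unfold htr; push_cast; ring
      rw [e1, e2, e3, Matrix.det_fin_two]
      simp [Matrix.algebraMap_matrix_apply]
      ring
    rw [e, mul_eq_zero, sub_eq_zero, sub_eq_zero]
  have hle : ∀ k ∈ spectrum ℂ (A.map Complex.ofReal), ‖k‖ ≤ rhoM A := by
    intro k hk
    rcases (hspec k).1 hk with h | h
    · rw [h, Complex.norm_real, Real.norm_eq_abs]
      calc |x + q| ≤ |x| + |q| := abs_add_le _ _
        _ = rhoM A := by rw [abs_of_nonneg hq0]; rfl
    · rw [h, Complex.norm_real, Real.norm_eq_abs]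
      calc |x - q| ≤ |x| + |q| := abs_sub _ _
        _ = rhoM A := by rw [abs_of_nonneg hq0]; rfl
  have hatt : ∃ k ∈ spectrum ℂ (A.map Complex.ofReal), ‖k‖ = rhoM A := by
    rcases le_total 0 x with h | h
    · refine ⟨_, (hspec _).2 (Or.inl rfl), ?_⟩
      rw [Complex.norm_real, Real.norm_eq_abs, abs_of_nonneg (by linarith)]
      show x + q = |x| + q
      rw [abs_of_nonneg h]
    · refine ⟨_, (hspec _).2 (Or.inr rfl), ?_⟩
      rw [Complex.norm_real, Real.norm_eq_abs, abs_of_nonpos (by linarith)]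
      show -(x - q) = |x| + q
      rw [abs_of_nonpos h]; ring
  have hr0 : 0 ≤ rhoM A := by unfold rhoM; positivity
  have : spectralRadius ℂ (A.map Complex.ofReal) = ENNReal.ofReal (rhoM A) := by
    refine le_antisymm ?_ ?_
    · refine iSup₂_le fun k hk => ?_
      rw [← enorm_eq_nnnorm, ← ofReal_norm]
      exact ENNReal.ofReal_le_ofReal (hle k hk)
    · obtain ⟨k, hk, hk2⟩ := hatt
      rw [← hk2, ofReal_norm, enorm_eq_nnnorm]
      exact le_iSup₂ (f := fun (k : ℂ) (_ : k ∈ spectrum ℂ (A.map Complex.ofReal)) =>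
        ((‖k‖₊ : NNReal) : ENNReal)) k hk
  rw [specRadR, this, ENNReal.toReal_ofReal hr0]

lemma log_rho {A : Matrix (Fin 2) (Fin 2) ℝ} (hA : A.det < 0) :
    Real.log (rhoM A) = Real.log (-A.det) / 2 + Real.arsinh (|htr A| / √(-A.det)) := by
  have hd : 0 < -A.det := by linarith
  have hs : 0 < √(-A.det) := Real.sqrt_pos.2 hd
  rw [← Real.log_sqrt hd.le, Real.arsinh, ← Real.log_mul hs.ne' (by positivity)]
  congr 1
  unfold rhoM
  have : htr A ^ 2 + -A.det = (-A.det) * (1 + (|htr A| / √(-A.det)) ^ 2) := by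
    rw [div_pow, sq_abs, Real.sq_sqrt hd.le, mul_add, mul_div_cancel₀ _ hd.ne']; ring
  rw [this, Real.sqrt_mul hd.le, mul_add]
  field_simp

lemma det_rot (φ : ℝ) (A : Matrix (Fin 2) (Fin 2) ℝ) : (rotMat φ * A).det = A.det := by
  rw [Matrix.det_mul]
  have : (rotMat φ).det = 1 := by
    rw [Matrix.det_fin_two]; simp [rotMat]; nlinarith [Real.sin_sq_add_cos_sq φ]
  rw [this, one_mul]

lemma htr_rot (φ : ℝ) (A : Matrix (Fin 2) (Fin 2) ℝ) :
    htr (rotMat φ * A) =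
      (A 0 0 + A 1 1) / 2 * Real.cos φ - (A 1 0 - A 0 1) / 2 * Real.sin φ := by
  unfold htr
  simp [rotMat, Matrix.mul_apply, Fin.sum_univ_two]
  ring

lemma htr_rot_phase (A : Matrix (Fin 2) (Fin 2) ℝ) :
    ∃ α : ℝ, ∀ φ, htr (rotMat φ * A) = √(naM A) * Real.cos (φ + α) := by
  set z : ℂ := ⟨(A 0 0 + A 1 1) / 2, (A 1 0 - A 0 1) / 2⟩ with hz
  have hn : ‖z‖ = √(naM A) := by
    rw [Complex.norm_def, Complex.normSq_apply]; congr 1; simp [hz, naM]; ring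
  refine ⟨z.arg, fun φ => ?_⟩
  rw [htr_rot, Real.cos_add, ← hn]
  have h1 : ‖z‖ * Real.cos z.arg = z.re := Complex.norm_mul_cos_arg z
  have h2 : ‖z‖ * Real.sin z.arg = z.im := Complex.norm_mul_sin_arg z
  calc _ = z.re * Real.cos φ - z.im * Real.sin φ := rfl
    _ = _ := by rw [← h1, ← h2]; ring

lemma na_rot (φ : ℝ) (A : Matrix (Fin 2) (Fin 2) ℝ) : naM (rotMat φ * A) = naM A := by
  unfold naM
  simp [rotMat, Matrix.mul_apply, Fin.sum_univ_two]
  have h := Real.sin_sq_add_cos_sq φ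
  have hc : Real.sin φ ^ 2 = 1 - Real.cos φ ^ 2 := by linarith
  ring_nf
  rw [hc]
  ring

/-- The rotational average of `log ρ`. -/
noncomputable def Gavg (A : Matrix (Fin 2) (Fin 2) ℝ) : ℝ :=
  (1 / (2 * Real.pi)) * ∫ φ in (0:ℝ)..(2 * Real.pi), Real.log (rhoM (rotMat φ * A))

lemma Gavg_eq {A : Matrix (Fin 2) (Fin 2) ℝ} (hA : A.det < 0) :
    Gavg A = Real.log (nbM A) / 2 + Dfun (√(naM A) / √(-A.det)) / Real.pi := by
  have hd : 0 < -A.det := by linarith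
  have hpi := Real.pi_pos
  obtain ⟨α, hα⟩ := htr_rot_phase A
  set t := √(naM A) / √(-A.det) with ht
  have h1 : ∀ φ, Real.log (rhoM (rotMat φ * A))
      = Real.log (-A.det) / 2 + Real.arsinh (t * |Real.cos (φ + α)|) := by
    intro φ
    rw [log_rho (by rw [det_rot]; exact hA), det_rot, hα, abs_mul,
      abs_of_nonneg (Real.sqrt_nonneg _), ht]
    congr 2
    ring
  have hcont : Continuous (fun φ => Real.arsinh (t * |Real.cos (φ + α)|)) :=
    Continuous.arsinh (by fun_prop)
  have hb : nbM A = (-A.det) * (1 + t ^ 2) := by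
    rw [nb_eq, ht, div_pow, Real.sq_sqrt (na_nonneg A), Real.sq_sqrt hd.le, mul_add, mul_div_cancel₀ _ hd.ne']
    ring
  unfold Gavg
  simp_rw [h1]
  rw [intervalIntegral.integral_add (by simp) (hcont.intervalIntegrable _ _),
    integral_arsinh_abs_cos, intervalIntegral.integral_const, hb,
    Real.log_mul hd.ne' (by positivity), Dfun, smul_eq_mul]
  field_simp
  ring

lemma norm_mulVec (A : Matrix (Fin 2) (Fin 2) ℝ) (θ : ℝ) :
    ‖toE2 (A.mulVec (unitVec θ))‖ =
      ‖(⟨(A 0 0 - A 1 1) / 2, (A 1 0 + A 0 1) / 2⟩ : ℂ) +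
        (⟨(A 0 0 + A 1 1) / 2, (A 1 0 - A 0 1) / 2⟩ : ℂ) * circleMap 0 1 θ ^ 2‖ := by
  have hz : circleMap 0 1 θ = ⟨Real.cos θ, Real.sin θ⟩ := by
    apply Complex.ext <;> simp [circleMap, Complex.exp_ofReal_mul_I_re, Complex.exp_ofReal_mul_I_im]
  rw [hz, EuclideanSpace.norm_eq, Complex.norm_def, Complex.normSq_apply]
  congr 1
  simp [toE2, unitVec, Matrix.mulVec, dotProduct, Fin.sum_univ_two, pow_two]
  have hs : Real.sin θ ^ 2 = 1 - Real.cos θ ^ 2 := by linarith [Real.sin_sq_add_cos_sq θ]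
  have hs4 : Real.sin θ ^ 4 = (1 - Real.cos θ ^ 2) ^ 2 := by rw [← hs]; ring
  ring_nf
  rw [hs4, hs]
  ring

lemma avg_log_norm {A : Matrix (Fin 2) (Fin 2) ℝ} (hA : A.det < 0) :
    (1 / (2 * Real.pi)) *
        ∫ θ in (0:ℝ)..(2 * Real.pi), Real.log ‖toE2 (A.mulVec (unitVec θ))‖
      = Real.log (nbM A) / 2 := by
  set b : ℂ := ⟨(A 0 0 - A 1 1) / 2, (A 1 0 + A 0 1) / 2⟩ with hb
  set a : ℂ := ⟨(A 0 0 + A 1 1) / 2, (A 1 0 - A 0 1) / 2⟩ with ha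
  have hna : ‖a‖ = √(naM A) := by
    rw [Complex.norm_def, Complex.normSq_apply]; congr 1; simp [ha, naM]; ring
  have hnb : ‖b‖ = √(nbM A) := by
    rw [Complex.norm_def, Complex.normSq_apply]; congr 1; simp [hb, nbM]; ring
  have hlt : ‖a‖ < ‖b‖ := by
    rw [hna, hnb]
    exact Real.sqrt_lt_sqrt (na_nonneg A) (by rw [nb_eq]; linarith)
  simp_rw [norm_mulVec]
  have hh : InnerProductSpace.HarmonicOnNhd (fun z : ℂ => Real.log ‖b + a * z ^ 2‖)
      (Metric.closedBall 0 |(1:ℝ)|) := by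
    intro z hz
    refine AnalyticAt.harmonicAt_log_norm (f := fun z => b + a * z ^ 2) (by fun_prop) ?_
    intro h0
    have hz1 : ‖z‖ ≤ 1 := by simpa using hz
    have : b = -(a * z ^ 2) := by linear_combination h0
    have h2 : ‖b‖ ≤ ‖a‖ := by
      rw [this, norm_neg, norm_mul, norm_pow]
      exact mul_le_of_le_one_right (norm_nonneg _) (pow_le_one₀ (norm_nonneg _) hz1)
    linarith
  have h := hh.circleAverage_eq
  rw [Real.circleAverage_def] at h
  simp only [smul_eq_mul] at h
  rw [one_div, h]
  simp [hnb, Real.log_sqrt (show 0 ≤ nbM A by rw [nb_eq]; linarith [na_nonneg A])]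

lemma mem_scalarO2_of_na {A : Matrix (Fin 2) (Fin 2) ℝ} (hA : A.det < 0) (h : naM A = 0) :
    A ∈ scalarO2 := by
  have hb : 0 < nbM A := by rw [nb_eq]; linarith
  have h1 : A 1 1 = - A 0 0 := by
    unfold naM at h; nlinarith [sq_nonneg (A 0 0 + A 1 1), sq_nonneg (A 1 0 - A 0 1)]
  have h2 : A 1 0 = A 0 1 := by
    unfold naM at h; nlinarith [sq_nonneg (A 0 0 + A 1 1), sq_nonneg (A 1 0 - A 0 1)]
  have hs : 0 < √(nbM A) := Real.sqrt_pos.2 hb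
  have hs2 : √(nbM A) ^ 2 = A 0 0 ^ 2 + A 0 1 ^ 2 := by
    rw [Real.sq_sqrt hb.le]; unfold nbM; rw [h1, h2]; ring
  refine ⟨√(nbM A), (√(nbM A))⁻¹ • A, ?_, ?_⟩
  · ext i j
    fin_cases i <;> fin_cases j <;>
      simp [Matrix.mul_apply, Fin.sum_univ_two, h1, h2] <;> field_simp <;> nlinarith
  · rw [smul_smul, mul_inv_cancel₀ hs.ne', one_smul]

lemma frob_le (A : Matrix (Fin 2) (Fin 2) ℝ) : naM A + nbM A ≤ opNormR A ^ 2 := by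
  have key : ∀ v : Fin 2 → ℝ, ‖toE2 (A.mulVec v)‖ ≤ opNormR A * ‖toE2 v‖ := by
    intro v
    exact (Matrix.toEuclideanCLM (𝕜 := ℝ) A).le_opNorm (toE2 v)
  have h0 := key ![1, 0]
  have h1 := key ![0, 1]
  have e0 : ‖toE2 ![1, 0]‖ = 1 := by simp [toE2, EuclideanSpace.norm_eq]
  have e1 : ‖toE2 ![0, 1]‖ = 1 := by simp [toE2, EuclideanSpace.norm_eq]
  rw [e0, mul_one] at h0
  rw [e1, mul_one] at h1
  have h0' := pow_le_pow_left₀ (norm_nonneg _) h0 2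
  have h1' := pow_le_pow_left₀ (norm_nonneg _) h1 2
  rw [EuclideanSpace.norm_sq_eq] at h0' h1'
  simp [toE2, Matrix.mulVec, dotProduct, Fin.sum_univ_two] at h0' h1'
  unfold naM nbM
  nlinarith

lemma frob_inv {A : Matrix (Fin 2) (Fin 2) ℝ} (hA : A.det < 0) :
    1 / (-A.det) ≤ opNormR A⁻¹ ^ 2 := by
  have hd : 0 < -A.det := by linarith
  have h := frob_le A⁻¹
  have hdi : A⁻¹.det = (A.det)⁻¹ := by
    rw [Matrix.det_nonsing_inv, Ring.inverse_eq_inv']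
  rw [nb_eq, hdi] at h
  have := na_nonneg A⁻¹
  have e : 1 / (-A.det) = -(A.det)⁻¹ := by rw [one_div, inv_neg]
  linarith

/-- The dominating function. -/
noncomputable def domM (A : Matrix (Fin 2) (Fin 2) ℝ) : ℝ :=
  max (Real.log (opNormR A)) 0 + max (Real.log (opNormR A⁻¹)) 0 + Real.log 2

lemma log_bound {A : Matrix (Fin 2) (Fin 2) ℝ} (hA : A.det < 0) {r : ℝ} (hr : 0 < r)
    (h1 : -A.det ≤ r ^ 2) (h2 : r ^ 2 ≤ 4 * (naM A + nbM A)) : |Real.log r| ≤ domM A := by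
  have hd : 0 < -A.det := by linarith
  have hN : 0 < naM A + nbM A := by rw [nb_eq]; linarith [na_nonneg A]
  have hop : 0 ≤ opNormR A := norm_nonneg _
  have hopi : 0 ≤ opNormR A⁻¹ := norm_nonneg _
  have hop' : 0 < opNormR A := by
    refine lt_of_le_of_ne hop fun h => ?_
    have := frob_le A
    rw [← h] at this; norm_num at this; linarith
  have hi := frob_inv hA
  have hopi' : 0 < opNormR A⁻¹ := by
    refine lt_of_le_of_ne hopi fun h => ?_
    rw [← h] at hi
    have : 0 < 1 / (-A.det) := by positivity
    norm_num at hi this; linarith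
  have hl2 : 0 ≤ Real.log 2 := Real.log_nonneg (by norm_num)
  have hm1 := le_max_left (Real.log (opNormR A)) 0
  have hm2 := le_max_left (Real.log (opNormR A⁻¹)) 0
  have hm3 := le_max_right (Real.log (opNormR A)) 0
  have hm4 := le_max_right (Real.log (opNormR A⁻¹)) 0
  rw [abs_le]
  unfold domM
  constructor
  · have : 1 ≤ r * opNormR A⁻¹ := by
      have h3 : 1 ≤ (r * opNormR A⁻¹) ^ 2 := by
        rw [div_le_iff₀ hd] at hi
        rw [mul_pow]
        nlinarith [sq_nonneg (opNormR A⁻¹)]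
      by_contra hcon
      push Not at hcon
      have : 0 ≤ r * opNormR A⁻¹ := by positivity
      nlinarith
    have h4 := Real.log_nonneg this
    rw [Real.log_mul hr.ne' hopi'.ne'] at h4
    linarith
  · have : r ≤ 2 * opNormR A := by
      refine abs_le_of_sq_le_sq' ?_ (by positivity) |>.2
      nlinarith [frob_le A]
    have h4 := Real.log_le_log hr this
    rw [Real.log_mul (by norm_num) hop'.ne'] at h4
    linarith

lemma log_rho_bound {A : Matrix (Fin 2) (Fin 2) ℝ} (hA : A.det < 0) (φ : ℝ) :
    |Real.log (rhoM (rotMat φ * A))| ≤ domM A := by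
  set B := rotMat φ * A with hB
  have hBd : B.det = A.det := det_rot φ A
  have hBa : naM B = naM A := na_rot φ A
  have hBb : nbM B = nbM A := by rw [nb_eq, nb_eq, hBd, hBa]
  have hd : 0 < -A.det := by linarith
  have h1 := htr_sq_le B
  have hpos : 0 ≤ htr B ^ 2 + -B.det := by rw [hBd]; positivity
  have hq2 : √(htr B ^ 2 + (-B.det)) ^ 2 = htr B ^ 2 + (-B.det) := Real.sq_sqrt hpos
  have hq0 : 0 ≤ √(htr B ^ 2 + (-B.det)) := Real.sqrt_nonneg _
  have hx := abs_nonneg (htr B)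
  have hx2 := sq_abs (htr B)
  have hnb := nb_eq B
  refine log_bound hA ?_ ?_ ?_
  · have : 0 < √(htr B ^ 2 + (-B.det)) := Real.sqrt_pos.2 (by rw [hBd]; positivity)
    unfold rhoM; positivity
  · unfold rhoM; rw [← hBd]; nlinarith
  · rw [← hBa, ← hBb]; unfold rhoM
    nlinarith [sq_nonneg (|htr B| - √(htr B ^ 2 + (-B.det))), na_nonneg B]

lemma log_nb_bound {A : Matrix (Fin 2) (Fin 2) ℝ} (hA : A.det < 0) :
    |Real.log (nbM A) / 2| ≤ domM A := by
  have hd : 0 < -A.det := by linarith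
  have hna := na_nonneg A
  have hb : 0 < nbM A := by rw [nb_eq]; linarith
  rw [← Real.log_sqrt hb.le]
  refine log_bound hA (Real.sqrt_pos.2 hb) ?_ ?_
  · rw [Real.sq_sqrt hb.le, nb_eq]; linarith
  · rw [Real.sq_sqrt hb.le]; linarith

lemma meas_entry (i j : Fin 2) :
    Measurable (fun A : Matrix (Fin 2) (Fin 2) ℝ => A i j) := by
  have : Continuous (fun A : Matrix (Fin 2) (Fin 2) ℝ => A i j) := by fun_prop
  exact this.measurable

lemma meas_rho : Measurable rhoM := by
  unfold rhoM htr
  simp_rw [Matrix.det_fin_two]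
  have h00 := meas_entry 0 0
  have h01 := meas_entry 0 1
  have h10 := meas_entry 1 0
  have h11 := meas_entry 1 1
  fun_prop

lemma meas_nb : Measurable nbM := by
  unfold nbM
  have h00 := meas_entry 0 0
  have h01 := meas_entry 0 1
  have h10 := meas_entry 1 0
  have h11 := meas_entry 1 1
  fun_prop

lemma meas_rho_rot : Measurable (fun p : Matrix (Fin 2) (Fin 2) ℝ × ℝ =>
    rhoM (rotMat p.2 * p.1)) := by
  have h00 : Measurable (fun p : Matrix (Fin 2) (Fin 2) ℝ × ℝ => p.1 0 0) :=
    (meas_entry 0 0).comp measurable_fst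
  have h01 : Measurable (fun p : Matrix (Fin 2) (Fin 2) ℝ × ℝ => p.1 0 1) :=
    (meas_entry 0 1).comp measurable_fst
  have h10 : Measurable (fun p : Matrix (Fin 2) (Fin 2) ℝ × ℝ => p.1 1 0) :=
    (meas_entry 1 0).comp measurable_fst
  have h11 : Measurable (fun p : Matrix (Fin 2) (Fin 2) ℝ × ℝ => p.1 1 1) :=
    (meas_entry 1 1).comp measurable_fst
  have hc : Measurable (fun p : Matrix (Fin 2) (Fin 2) ℝ × ℝ => Real.cos p.2) :=
    Real.measurable_cos.comp measurable_snd
  have hs : Measurable (fun p : Matrix (Fin 2) (Fin 2) ℝ × ℝ => Real.sin p.2) :=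
    Real.measurable_sin.comp measurable_snd
  have htr : Measurable (fun p : Matrix (Fin 2) (Fin 2) ℝ × ℝ => htr (rotMat p.2 * p.1)) := by
    simp_rw [htr_rot]
    exact (((h00.add h11).div_const 2).mul hc).sub (((h10.sub h01).div_const 2).mul hs)
  have hdt : Measurable (fun p : Matrix (Fin 2) (Fin 2) ℝ × ℝ => (rotMat p.2 * p.1).det) := by
    simp_rw [det_rot, Matrix.det_fin_two]
    exact (h00.mul h11).sub (h01.mul h10)
  exact (measurable_norm.comp htr).add (((htr.pow_const 2).add hdt.neg).sqrt)

/-- (Dedieu–Shub) Let `μ` be an `SO(2)`-invariant Borel probability measure on `GL⁻(2,ℝ)`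
with `log⁺‖A‖` and `log⁺‖A⁻¹‖` integrable, whose support is not contained in `ℝ·O(2)`
(since `ℝ·O(2)` is closed, this means `μ` gives positive mass to its complement).  Then
`∫ log ρ(A) dμ(A) > ∫ (1/(2π)) ∫₀^{2π} log ‖A·u(θ)‖ dθ dμ(A)`. -/
theorem so2_invariant_GLminus_strict_inequality
    (μ : Measure (Matrix (Fin 2) (Fin 2) ℝ)) [IsProbabilityMeasure μ]
    (hdet : μ {A | A.det < 0}ᶜ = 0)
    (hlog1 : Integrable (fun A => max (Real.log (opNormR A)) 0) μ)
    (hlog2 : Integrable (fun A => max (Real.log (opNormR A⁻¹)) 0) μ)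
    (hinv : ∀ φ : ℝ, Measure.map (fun A => rotMat φ * A) μ = μ)
    (hsupp : μ scalarO2ᶜ ≠ 0) :
    ∫ A, Real.log (specRadR A) ∂μ >
      ∫ A, ((1 / (2 * Real.pi)) *
        ∫ θ in (0:ℝ)..(2 * Real.pi), Real.log ‖toE2 (A.mulVec (unitVec θ))‖) ∂μ := by
  have hae : ∀ᵐ A ∂μ, A.det < 0 := by
    rw [ae_iff]
    exact hdet
  have hpi := Real.pi_pos
  have hdom : Integrable domM μ := by
    unfold domM
    exact (hlog1.add hlog2).add (integrable_const _)
  -- the two integrands in explicit form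
  have hL : ∫ A, Real.log (specRadR A) ∂μ = ∫ A, Real.log (rhoM A) ∂μ := by
    refine integral_congr_ae ?_
    filter_upwards [hae] with A hA
    rw [specRad_eq hA]
  have hR : ∫ A, ((1 / (2 * Real.pi)) *
        ∫ θ in (0:ℝ)..(2 * Real.pi), Real.log ‖toE2 (A.mulVec (unitVec θ))‖) ∂μ
      = ∫ A, Real.log (nbM A) / 2 ∂μ := by
    refine integral_congr_ae ?_
    filter_upwards [hae] with A hA
    exact avg_log_norm hA
  have hJint : Integrable (fun A => Real.log (nbM A) / 2) μ := by
    refine hdom.mono' ((Real.measurable_log.comp meas_nb).div_const 2).aestronglyMeasurable ?_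
    filter_upwards [hae] with A hA
    exact log_nb_bound hA
  -- Fubini
  set ν : Measure ℝ := volume.restrict (Set.Ioc 0 (2 * Real.pi)) with hν
  have hprod : Integrable (Function.uncurry
      (fun (A : Matrix (Fin 2) (Fin 2) ℝ) (φ : ℝ) => Real.log (rhoM (rotMat φ * A))))
      (μ.prod ν) := by
    refine (hdom.comp_fst ν).mono' (Real.measurable_log.comp meas_rho_rot).aestronglyMeasurable ?_
    have : ∀ᵐ p ∂(μ.prod ν), p.1.det < 0 := Measure.quasiMeasurePreserving_fst.ae hae
    filter_upwards [this] with p hp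
    exact log_rho_bound hp p.2
  have hG : Gavg = fun A => (1 / (2 * Real.pi)) * ∫ φ, Real.log (rhoM (rotMat φ * A)) ∂ν := by
    funext A
    unfold Gavg
    rw [intervalIntegral.integral_of_le (by positivity)]
  have hGint : Integrable Gavg μ := by
    rw [hG]
    exact (hprod.integral_prod_left).const_mul _
  have hrot : ∀ φ, ∫ A, Real.log (rhoM (rotMat φ * A)) ∂μ = ∫ A, Real.log (rhoM A) ∂μ := by
    intro φ
    have hm : Measurable (fun A : Matrix (Fin 2) (Fin 2) ℝ => rotMat φ * A) := by
      have : Continuous (fun A : Matrix (Fin 2) (Fin 2) ℝ => rotMat φ * A) := by fun_prop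
      exact this.measurable
    conv_rhs => rw [← hinv φ]
    exact (integral_map (f := fun A => Real.log (rhoM A)) hm.aemeasurable
      (Real.measurable_log.comp meas_rho).aestronglyMeasurable).symm
  have hGL : ∫ A, Gavg A ∂μ = ∫ A, Real.log (rhoM A) ∂μ := by
    rw [hG, integral_const_mul, integral_integral_swap hprod]
    simp_rw [hrot]
    rw [integral_const, hν]
    simp [Real.volume_real_Ioc, max_eq_left (by positivity : (0:ℝ) ≤ 2 * Real.pi)]
    field_simp
  rw [hL, hR, ← hGL, gt_iff_lt, ← sub_pos, ← integral_sub hGint hJint]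
  have hdiff : ∀ᵐ A ∂μ, Gavg A - Real.log (nbM A) / 2
      = Dfun (√(naM A) / √(-A.det)) / Real.pi := by
    filter_upwards [hae] with A hA
    rw [Gavg_eq hA]; ring
  have hpos : ∀ A : Matrix (Fin 2) (Fin 2) ℝ, A.det < 0 → naM A ≠ 0 →
      0 < Dfun (√(naM A) / √(-A.det)) / Real.pi := by
    intro A hA hn
    refine div_pos (Dfun_pos (div_pos (Real.sqrt_pos.2 ?_) (Real.sqrt_pos.2 (by linarith)))) hpi
    exact lt_of_le_of_ne (na_nonneg A) (Ne.symm hn)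
  refine (integral_pos_iff_support_of_nonneg_ae ?_ (hGint.sub hJint)).2 ?_
  swap
  · rw [pos_iff_ne_zero]
    intro h0
    apply hsupp
    have h1 : ∀ᵐ A ∂μ, Gavg A - Real.log (nbM A) / 2 = 0 := by
      rw [ae_iff]; exact h0
    have h2 : ∀ᵐ A ∂μ, A ∈ scalarO2 := by
      filter_upwards [h1, hdiff, hae] with A h1 h2 hA
      by_contra hcon
      have hn : naM A ≠ 0 := fun h => hcon (mem_scalarO2_of_na hA h)
      have := hpos A hA hn
      rw [← h2, h1] at this
      exact lt_irrefl _ this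
    rw [ae_iff] at h2
    exact h2
  · filter_upwards [hdiff, hae] with A h2 hA
    show 0 ≤ Gavg A - Real.log (nbM A) / 2
    rw [h2]
    by_cases hn : naM A = 0
    · rw [hn]; simp [Dfun_zero]
    · exact (hpos A hA hn).le
end

section
/- Let A be a 2×2 real matrix with det A > 0, let R_φ = [[cos φ, −sin φ],[sin φ, cos φ]], and let u(θ) = (cos θ, sin θ). Then (1/(2π)) · ∫₀^{2π} log ρ(R_φ · A) dφ = (1/(2π)) · ∫₀^{2π} log ‖A·u(θ)‖ dθ, where ρ(B) denotes the spectral radius of B. In words: for the SO(2)-invariant family SO(2)·A, the average of the logarithm of the largest eigenvalue modulus equals the largest random Lyapunov exponent of the family. -/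
open MeasureTheory in
lemma kernel_int (a : ℝ) (ha : 0 < a) (t : ℝ) (x y : ℂ) (hs : x + y = t) (hp : x * y = (a:ℂ) ^ 2) :
    IntervalIntegrable (fun ψ => Real.log |2 * a * Real.cos ψ - t|) volume 0 (2 * Real.pi) ∧
    ∫ ψ in (0:ℝ)..(2 * Real.pi), Real.log |2 * a * Real.cos ψ - t| =
      2 * Real.pi * Real.log (max ‖x‖ ‖y‖) := by
  wlog hxy : ‖y‖ ≤ ‖x‖ generalizing x y
  · have := this y x (by rw [← hs]; ring) (by rw [← hp]; ring) (le_of_not_ge hxy)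
    rwa [max_comm] at this
  have hpn : ‖x‖ * ‖y‖ = a ^ 2 := by
    rw [← norm_mul, hp]; simp
  have hax : a ≤ ‖x‖ := by
    by_contra h
    push Not at h
    nlinarith [norm_nonneg x, norm_nonneg y]
  have hya : ‖y‖ ≤ a := by
    by_contra h
    push Not at h
    nlinarith [norm_nonneg x, norm_nonneg y]
  have hx0 : 0 < ‖x‖ := ha.trans_le hax
  have ix := circleIntegrable_log_norm_sub_const (a := x) (c := 0) a
  have iy := circleIntegrable_log_norm_sub_const (a := y) (c := 0) a
  have ex := circleAverage_log_norm_sub_const_eq_log_radius_add_posLog (a := x) (c := 0) ha.ne'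
  have ey := circleAverage_log_norm_sub_const_eq_log_radius_add_posLog (a := y) (c := 0) ha.ne'
  have px : Real.posLog (a⁻¹ * ‖0 - x‖) = Real.log ‖x‖ - Real.log a := by
    rw [zero_sub, norm_neg, Real.posLog_eq_log, Real.log_mul (by positivity) hx0.ne', Real.log_inv]
    · ring
    · rw [abs_of_nonneg (by positivity), inv_mul_eq_div, one_le_div ha]; exact hax
  have py : Real.posLog (a⁻¹ * ‖0 - y‖) = 0 := by
    rw [zero_sub, norm_neg, Real.posLog_eq_zero_iff, abs_of_nonneg (by positivity), inv_mul_eq_div,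
      div_le_one ha]; exact hya
  rw [px, Real.circleAverage_def, smul_eq_mul, inv_mul_eq_iff_eq_mul₀ (by positivity)] at ex
  rw [py, Real.circleAverage_def, smul_eq_mul, inv_mul_eq_iff_eq_mul₀ (by positivity)] at ey
  unfold CircleIntegrable at ix iy
  have hae : ∀ᵐ ψ : ℝ, Real.log |2 * a * Real.cos ψ - t| =
      Real.log ‖circleMap 0 a ψ - x‖ + Real.log ‖circleMap 0 a ψ - y‖ - Real.log a := by
    have n1 : ∀ᵐ ψ : ℝ, ψ ∉ circleMap 0 a ⁻¹' {x} :=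
      measure_eq_zero_iff_ae_notMem.1
        (((Set.countable_singleton x).preimage_circleMap 0 ha.ne').measure_zero volume)
    have n2 : ∀ᵐ ψ : ℝ, ψ ∉ circleMap 0 a ⁻¹' {y} :=
      measure_eq_zero_iff_ae_notMem.1
        (((Set.countable_singleton y).preimage_circleMap 0 ha.ne').measure_zero volume)
    filter_upwards [n1, n2] with ψ h1 h2
    have h1' : ‖circleMap 0 a ψ - x‖ ≠ 0 := by
      simpa [sub_eq_zero] using h1
    have h2' : ‖circleMap 0 a ψ - y‖ ≠ 0 := by
      simpa [sub_eq_zero] using h2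
    have key : ‖circleMap 0 a ψ - x‖ * ‖circleMap 0 a ψ - y‖ = a * |2 * a * Real.cos ψ - t| := by
      have e : (circleMap 0 a ψ - x) * (circleMap 0 a ψ - y) =
          (circleMap 0 a ψ) * ((2 * a * Real.cos ψ - t : ℝ) : ℂ) := by
        have : (circleMap 0 a ψ - x) * (circleMap 0 a ψ - y) =
          circleMap 0 a ψ ^ 2 - (x + y) * circleMap 0 a ψ + x * y := by ring
        rw [this, hs, hp]
        have e2 : Complex.exp (ψ * Complex.I) * Complex.exp (-(ψ * Complex.I)) = 1 := by
          rw [← Complex.exp_add]; simp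
        simp only [circleMap, zero_add]
        push_cast
        rw [Complex.cos, neg_mul]
        linear_combination (-(a:ℂ)^2) * e2
      rw [← norm_mul, e, norm_mul, Complex.norm_real, Real.norm_eq_abs]
      simp [abs_of_pos ha]
    have h3 : |2 * a * Real.cos ψ - t| ≠ 0 := by
      intro h
      rw [h, mul_zero] at key
      exact mul_ne_zero h1' h2' key
    rw [← Real.log_mul h1' h2', key, Real.log_mul ha.ne' h3]; ring
  constructor
  · refine ((ix.add iy).sub (intervalIntegrable_const (c := Real.log a))).congr_ae ?_
    refine ae_restrict_of_ae ?_
    filter_upwards [hae] with ψ h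
    rw [h]
  · rw [intervalIntegral.integral_congr_ae (g := fun ψ => Real.log ‖circleMap 0 a ψ - x‖ +
      Real.log ‖circleMap 0 a ψ - y‖ - Real.log a) (hae.mono fun _ h _ => h),
      intervalIntegral.integral_sub (ix.add iy) (intervalIntegrable_const),
      intervalIntegral.integral_add ix iy, ex, ey, max_eq_left hxy, intervalIntegral.integral_const, smul_eq_mul]
    ring

lemma specRad_eq_s13 (B : Matrix (Fin 2) (Fin 2) ℝ) (x y : ℂ) (hs : x + y = (B.trace : ℝ))
    (hp : x * y = (B.det : ℝ)) : specRadR B = max ‖x‖ ‖y‖ := by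
  have hsp : spectrum ℂ (B.map Complex.ofReal) = {x, y} := by
    ext z
    rw [Matrix.mem_spectrum_iff_isRoot_charpoly, Matrix.charpoly_fin_two]
    have h1 : (B.map Complex.ofReal).trace = x + y := by
      rw [hs]; simp [Matrix.trace]
    have h2 : (B.map Complex.ofReal).det = x * y := by
      rw [hp]; simp [Matrix.det_fin_two]
    rw [h1, h2]
    have : z ^ 2 - (x + y) * z + x * y = (z - x) * (z - y) := by ring
    simp [this, sub_eq_zero]
  unfold specRadR spectralRadius
  rw [hsp, iSup_pair]
  rw [ENNReal.toReal_sup (by simp) (by simp)]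
  simp

lemma exists_roots (s p : ℂ) : ∃ x y : ℂ, x + y = s ∧ x * y = p := by
  obtain ⟨w, hw⟩ := IsAlgClosed.exists_pow_nat_eq (s ^ 2 - 4 * p) (n := 2) (by norm_num)
  refine ⟨(s + w) / 2, (s - w) / 2, by ring, ?_⟩
  linear_combination (-1/4) * hw

lemma log_spec (B : Matrix (Fin 2) (Fin 2) ℝ) (d : ℝ) (hd : 0 < d) (hB : B.det = d ^ 2) :
    ∫ ψ in (0:ℝ)..(2 * Real.pi), Real.log |2 * d * Real.cos ψ - B.trace| =
      2 * Real.pi * Real.log (specRadR B) := by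
  obtain ⟨x, y, hs, hp⟩ := exists_roots (B.trace : ℝ) (B.det : ℝ)
  rw [specRad_eq_s13 B x y hs hp]
  exact (kernel_int d hd _ x y hs (by rw [hp, hB]; push_cast; rfl)).2

open MeasureTheory in
lemma inner_P (P : ℝ) (hP : 0 < P) (s : ℝ) (hsP : |s| ≤ P) :
    IntervalIntegrable (fun ψ => Real.log |2 * P * Real.cos ψ - 2 * s|) volume 0 (2 * Real.pi) ∧
    ∫ ψ in (0:ℝ)..(2 * Real.pi), Real.log |2 * P * Real.cos ψ - 2 * s| =
      2 * Real.pi * Real.log P := by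
  have h0 : 0 ≤ P ^ 2 - s ^ 2 := by
    have := sq_le_sq' (abs_le.1 hsP).1 (abs_le.1 hsP).2
    linarith
  set r := Real.sqrt (P ^ 2 - s ^ 2) with hr
  have hr2 : r ^ 2 = P ^ 2 - s ^ 2 := Real.sq_sqrt h0
  have hr2' : (r:ℂ) ^ 2 = P ^ 2 - s ^ 2 := by exact_mod_cast hr2
  have hn : ∀ v : ℝ, v ^ 2 = r ^ 2 → ‖(⟨s, v⟩ : ℂ)‖ = P := by
    intro v hv
    rw [← Real.sqrt_sq hP.le, Complex.norm_def, Complex.normSq_mk]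
    congr 1
    nlinarith
  have := kernel_int P hP (2 * s) ⟨s, r⟩ ⟨s, -r⟩ (by apply Complex.ext <;> simp; ring)
    (by apply Complex.ext
        · simp [pow_two]; nlinarith
        · simp [pow_two]; ring)
  rwa [hn r rfl, hn (-r) (by ring), max_self] at this

open MeasureTheory in
lemma double_int (P d : ℝ) (hd : 0 < d) (hdP : d ≤ P) (α : ℝ) :
    ∫ φ in (0:ℝ)..(2 * Real.pi), ∫ ψ in (0:ℝ)..(2 * Real.pi),
      Real.log |2 * d * Real.cos ψ - 2 * P * Real.cos (φ + α)| =
      2 * Real.pi * (2 * Real.pi * Real.log P) := by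
  have hP : 0 < P := hd.trans_le hdP
  have hpi : (0:ℝ) ≤ 2 * Real.pi := by positivity
  -- for fixed ψ
  have hin : ∀ ψ : ℝ,
      IntervalIntegrable (fun φ => Real.log |2 * d * Real.cos ψ - 2 * P * Real.cos (φ + α)|)
        volume 0 (2 * Real.pi) ∧
      ∫ φ in (0:ℝ)..(2 * Real.pi), Real.log |2 * d * Real.cos ψ - 2 * P * Real.cos (φ + α)| =
        2 * Real.pi * Real.log P := by
    intro ψ
    have hle : |d * Real.cos ψ| ≤ P := by
      rw [abs_mul, abs_of_pos hd]
      nlinarith [Real.abs_cos_le_one ψ]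
    obtain ⟨h1, h2⟩ := inner_P P hP (d * Real.cos ψ) hle
    have hper : Function.Periodic
        (fun φ => Real.log |2 * P * Real.cos φ - 2 * (d * Real.cos ψ)|) (2 * Real.pi) := by
      intro φ; simp
    have hf : (fun φ => Real.log |2 * d * Real.cos ψ - 2 * P * Real.cos (φ + α)|) =
        fun φ => (fun φ => Real.log |2 * P * Real.cos φ - 2 * (d * Real.cos ψ)|) (φ + α) := by
      funext φ
      rw [abs_sub_comm]
      simp only [mul_assoc]
    rw [hf]
    constructor
    · have := (hper.intervalIntegrable₀ (by positivity) h1 α (2 * Real.pi + α)).comp_add_right α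
      simpa using this
    · rw [intervalIntegral.integral_comp_add_right
        (fun φ => Real.log |2 * P * Real.cos φ - 2 * (d * Real.cos ψ)|), ← h2, zero_add, add_comm (2 * Real.pi) α,
        hper.intervalIntegral_add_eq α 0, zero_add]
  set F : ℝ → ℝ → ℝ := fun φ ψ =>
    Real.log |2 * d * Real.cos ψ - 2 * P * Real.cos (φ + α)| with hF
  have hmeas : Measurable (Function.uncurry F) := by
    simp only [hF, Function.uncurry_def]
    fun_prop
  set M := Real.log (4 * P) with hM
  have hub : ∀ φ ψ, F φ ψ ≤ |M| := by
    intro φ ψ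
    by_cases h0 : |2 * d * Real.cos ψ - 2 * P * Real.cos (φ + α)| = 0
    · simp only [hF, h0, Real.log_zero]; positivity
    refine le_trans (Real.log_le_log (lt_of_le_of_ne (abs_nonneg _) (Ne.symm h0)) ?_) (le_abs_self _)
    refine (abs_sub _ _).trans ?_
    rw [abs_mul (2 * d), abs_mul (2 * P), abs_of_pos (by positivity : 0 < 2 * d), abs_of_pos (by positivity : 0 < 2 * P)]
    nlinarith [Real.abs_cos_le_one ψ, Real.abs_cos_le_one (φ + α), abs_nonneg (Real.cos ψ)]
  have hint : Integrable (Function.uncurry F)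
      ((volume.restrict (Set.Ioc 0 (2 * Real.pi))).prod (volume.restrict (Set.Ioc 0 (2 * Real.pi)))) := by
    rw [integrable_prod_iff' hmeas.aestronglyMeasurable]
    have hi : ∀ ψ, Integrable (fun φ => F φ ψ) (volume.restrict (Set.Ioc 0 (2 * Real.pi))) :=
      fun ψ => (intervalIntegrable_iff_integrableOn_Ioc_of_le hpi).1 (hin ψ).1
    refine ⟨Filter.Eventually.of_forall hi, ?_⟩
    refine Integrable.mono' (g := fun _ => 2 * Real.pi * (2 * |M|) - 2 * Real.pi * Real.log P)
      (integrable_const _) ?_ (Filter.Eventually.of_forall fun ψ => ?_)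
    · exact (hmeas.aestronglyMeasurable.prod_swap.norm.integral_prod_right')
    · rw [Real.norm_of_nonneg (integral_nonneg fun _ => norm_nonneg _)]
      have e : ∫ φ in Set.Ioc 0 (2 * Real.pi), (2 * |M| - F φ ψ) =
          2 * Real.pi * (2 * |M|) - 2 * Real.pi * Real.log P := by
        rw [integral_sub (integrable_const _) (hi ψ), ← (hin ψ).2,
          intervalIntegral.integral_of_le hpi]
        simp only [integral_const, smul_eq_mul]
        simp [hpi, -Real.log_abs, hF]
      rw [← e]
      refine integral_mono (hi ψ).norm ((integrable_const _).sub (hi ψ)) fun φ => ?_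
      have := hub φ ψ
      simp only [Function.uncurry, Real.norm_eq_abs]
      rcases abs_cases (F φ ψ) with h | h <;> nlinarith [abs_nonneg M]
  have swap := integral_integral_swap hint
  simp only [intervalIntegral.integral_of_le hpi]
  rw [swap]
  have : ∀ ψ, ∫ φ in Set.Ioc 0 (2 * Real.pi), F φ ψ = 2 * Real.pi * Real.log P := fun ψ => by
    rw [← (hin ψ).2, intervalIntegral.integral_of_le hpi]
  simp [this, hpi]

lemma rhs_int (p q : ℂ) (hpq : ‖q‖ < ‖p‖) :
    ∫ θ in (0:ℝ)..(2 * Real.pi), Real.log ‖p * Complex.exp (θ * Complex.I) +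
      q * Complex.exp (-(θ * Complex.I))‖ = 2 * Real.pi * Real.log ‖p‖ := by
  have h := AnalyticOnNhd.circleAverage_log_norm_of_ne_zero (R := 1) (c := 0)
    (g := fun z => star p + star q * z ^ 2) (fun z _ => by fun_prop) (by
      intro u hu h0
      have hu : ‖u‖ ≤ 1 := by simpa using hu
      have : star p = -(star q * u ^ 2) := by linear_combination h0
      have h2 := congrArg norm this
      simp only [norm_star, norm_neg, norm_mul, norm_pow] at h2
      have : ‖u‖ ^ 2 ≤ 1 := by nlinarith [norm_nonneg u]
      nlinarith [norm_nonneg q])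
  rw [Real.circleAverage_def, smul_eq_mul, inv_mul_eq_iff_eq_mul₀ (by positivity)] at h
  simp only [ne_eq, OfNat.ofNat_ne_zero, not_false_eq_true, zero_pow, mul_zero, add_zero,
    norm_star] at h
  rw [← h]
  congr 1
  funext θ
  congr 1
  have e1 : star (p * Complex.exp (θ * Complex.I) + q * Complex.exp (-(θ * Complex.I))) *
      Complex.exp (θ * Complex.I) = star p + star q * circleMap 0 1 θ ^ 2 := by
    have e2 : Complex.exp (θ * Complex.I) * Complex.exp (-(θ * Complex.I)) = 1 := by
      rw [← Complex.exp_add]; simp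
    simp only [circleMap, star_add, star_mul', Complex.star_def, ← Complex.exp_conj, map_neg,
      map_mul, Complex.conj_I, Complex.conj_ofReal, mul_neg, neg_neg, zero_add, Complex.ofReal_one,
      one_mul]
    linear_combination (starRingEnd ℂ p) * e2
  rw [← e1, norm_mul, norm_star, Complex.norm_exp_ofReal_mul_I, mul_one]

/-- For a 2×2 real matrix `A` with `det A > 0`, the average over `SO(2)` of the log of the
largest eigenvalue modulus of `R_φ·A` equals the largest random Lyapunov exponent of the
family `SO(2)·A`:
`(1/(2π)) ∫₀^{2π} log ρ(R_φ A) dφ = (1/(2π)) ∫₀^{2π} log ‖A·u(θ)‖ dθ`. -/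
theorem so2_coset_equality (A : Matrix (Fin 2) (Fin 2) ℝ) (hA : 0 < A.det) :
    (1 / (2 * Real.pi)) *
        ∫ φ in (0:ℝ)..(2 * Real.pi), Real.log (specRadR (rotMat φ * A)) =
      (1 / (2 * Real.pi)) *
        ∫ θ in (0:ℝ)..(2 * Real.pi), Real.log ‖toE2 (A.mulVec (unitVec θ))‖ := by
  congr 1
  set p : ℂ := ⟨(A 0 0 + A 1 1) / 2, (A 1 0 - A 0 1) / 2⟩ with hp
  set q : ℂ := ⟨(A 0 0 - A 1 1) / 2, (A 1 0 + A 0 1) / 2⟩ with hq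
  have hdet : A.det = ‖p‖ ^ 2 - ‖q‖ ^ 2 := by
    rw [Complex.sq_norm, Complex.sq_norm, Complex.normSq_mk, Complex.normSq_mk, Matrix.det_fin_two]
    ring
  have hqp : ‖q‖ < ‖p‖ := by
    apply lt_of_pow_lt_pow_left₀ 2 (norm_nonneg _)
    linarith
  set d := Real.sqrt A.det with hd
  have hd0 : 0 < d := Real.sqrt_pos.2 hA
  have hd2 : d ^ 2 = A.det := Real.sq_sqrt hA.le
  have hdp : d ≤ ‖p‖ := by
    refine (pow_le_pow_iff_left₀ hd0.le (norm_nonneg _) two_ne_zero).1 ?_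
    nlinarith [sq_nonneg ‖q‖]
  have hL : ∀ φ : ℝ, 2 * Real.pi * Real.log (specRadR (rotMat φ * A)) =
      ∫ ψ in (0:ℝ)..(2 * Real.pi),
        Real.log |2 * d * Real.cos ψ - 2 * ‖p‖ * Real.cos (φ + p.arg)| := by
    intro φ
    rw [← log_spec _ d hd0]
    · have : (rotMat φ * A).trace = 2 * ‖p‖ * Real.cos (φ + p.arg) := by
        rw [Real.cos_add]
        have h1 := Complex.norm_mul_cos_arg p
        have h2 := Complex.norm_mul_sin_arg p
        have : 2 * ‖p‖ * (Real.cos φ * Real.cos p.arg - Real.sin φ * Real.sin p.arg) =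
          2 * (Real.cos φ * p.re - Real.sin φ * p.im) := by
          rw [← h1, ← h2]; ring
        rw [this]
        simp [rotMat, Matrix.trace, Matrix.vecMul, dotProduct, Fin.sum_univ_two, hp]
        ring
      rw [this]
    · rw [Matrix.det_mul, hd2, rotMat, Matrix.det_fin_two_of]
      linear_combination A.det * Real.sin_sq_add_cos_sq φ
  have hR : ∀ θ : ℝ, ‖toE2 (A.mulVec (unitVec θ))‖ =
      ‖p * Complex.exp (θ * Complex.I) + q * Complex.exp (-(θ * Complex.I))‖ := by
    intro θ
    have e : p * Complex.exp (θ * Complex.I) + q * Complex.exp (-(θ * Complex.I)) =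
        ⟨A 0 0 * Real.cos θ + A 0 1 * Real.sin θ, A 1 0 * Real.cos θ + A 1 1 * Real.sin θ⟩ := by
      rw [← neg_mul, ← Complex.ofReal_neg]
      apply Complex.ext <;>
      simp [Complex.exp_ofReal_mul_I_re, Complex.exp_ofReal_mul_I_im, hp, hq,
        -Complex.ofReal_neg] <;> ring
    rw [e, EuclideanSpace.norm_eq, Complex.norm_def, Complex.normSq_mk]
    congr 1
    simp [toE2, unitVec, Matrix.mulVec, dotProduct, Fin.sum_univ_two]
    ring
  simp only [hR]
  rw [rhs_int p q hqp]
  have hD := double_int ‖p‖ d hd0 hdp p.arg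
  simp only [← hL] at hD
  rw [intervalIntegral.integral_const_mul] at hD
  exact mul_left_cancel₀ (by positivity) hD
end

section
/- Let n ≥ 1 and let A be an n×n complex matrix with spectral radius ρ(A) > 0. Then for every ε with 0 < ε < ρ(A) there exists δ > 0 such that for every k ≥ 1 and every finite sequence B₁, …, B_k of n×n complex matrices with ‖B_i − A‖_op ≤ δ for all i, one has ‖B_k · B_{k−1} · ⋯ · B₁‖_op ≥ (ρ(A) − ε)^k. -/
/-- The operator norm of an `n×n` complex matrix acting on `ℂⁿ` with the Hermitian norm. -/
noncomputable def opNormC {n : ℕ} (A : Matrix (Fin n) (Fin n) ℂ) : ℝ :=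
  ‖Matrix.toEuclideanCLM (𝕜 := ℂ) A‖

open scoped Matrix.Norms.L2Operator in
theorem entry_le_norm_aux {n : ℕ} (M : Matrix (Fin n) (Fin n) ℂ) (i j : Fin n) :
    ‖M i j‖ ≤ ‖M‖ := by
  have h := Matrix.l2_opNorm_mulVec M (EuclideanSpace.single j (1:ℂ))
  rw [EuclideanSpace.norm_single, norm_one, mul_one] at h
  refine le_trans ?_ h
  refine le_trans (le_of_eq ?_) (PiLp.norm_apply_le _ i)
  simp

/-- Every complex matrix is similar to an upper triangular one. -/
theorem tri_aux : ∀ (n : ℕ) (A : Matrix (Fin n) (Fin n) ℂ),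
    ∃ P Q : Matrix (Fin n) (Fin n) ℂ, P * Q = 1 ∧ Q * P = 1 ∧
      ∀ i j, j < i → (Q * A * P) i j = 0 := by
  intro n
  induction n with
  | zero => intro A; exact ⟨1, 1, by simp, by simp, fun i => i.elim0⟩
  | succ n ih =>
    intro A
    obtain ⟨z, hz⟩ := Module.End.exists_eigenvalue (Matrix.toLin' A)
    obtain ⟨v, hv⟩ := hz.exists_hasEigenvector
    have hAv : A.mulVec v = z • v := by simpa using hv.apply_eq_smul
    have he : (Pi.single 0 1 : Fin (n+1) → ℂ) ≠ 0 := by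
      intro h; simpa using congrFun h 0
    obtain ⟨e, hev⟩ := SeparatingDual.exists_continuousLinearEquiv_apply_eq (R := ℂ) he hv.2
    let P := LinearMap.toMatrix' (e.toLinearEquiv : (Fin (n+1) → ℂ) →ₗ[ℂ] (Fin (n+1) → ℂ))
    let Q := LinearMap.toMatrix' (e.toLinearEquiv.symm : (Fin (n+1) → ℂ) →ₗ[ℂ] (Fin (n+1) → ℂ))
    have hPQ : P * Q = 1 := by
      simp only [P, Q]
      rw [← LinearMap.toMatrix'_comp, LinearEquiv.comp_symm, LinearMap.toMatrix'_id]
    have hQP : Q * P = 1 := by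
      simp only [P, Q]
      rw [← LinearMap.toMatrix'_comp, LinearEquiv.symm_comp, LinearMap.toMatrix'_id]
    have hP0 : P.mulVec (Pi.single 0 1) = v := by
      rw [← Matrix.toLin'_apply, Matrix.toLin'_toMatrix']
      exact hev
    have hQv : Q.mulVec v = Pi.single 0 1 := by
      rw [← hP0, Matrix.mulVec_mulVec, hQP, Matrix.one_mulVec]
    have hcol : ∀ i : Fin n, (Q * A * P) i.succ 0 = 0 := by
      intro i
      have : (Q * A * P).mulVec (Pi.single 0 1) = z • Pi.single 0 1 := by
        rw [← Matrix.mulVec_mulVec, hP0, ← Matrix.mulVec_mulVec, hAv, Matrix.mulVec_smul, hQv]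
      have := congrFun this i.succ
      simpa using this
    set M := Q * A * P with hM
    obtain ⟨P', Q', h1, h2, h3⟩ := ih (M.submatrix Fin.succ Fin.succ)
    let ext : Matrix (Fin n) (Fin n) ℂ → Matrix (Fin (n+1)) (Fin (n+1)) ℂ := fun X =>
      Matrix.of (Fin.cons (Fin.cons 1 0) (fun i => Fin.cons 0 (X i)))
    have ext_mul : ∀ X Y, ext X * ext Y = ext (X * Y) := by
      intro X Y
      ext i j
      refine Fin.cases ?_ (fun i => ?_) i <;> refine Fin.cases ?_ (fun j => ?_) j <;>
        simp [ext, Matrix.mul_apply, Fin.sum_univ_succ]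
    have ext_one : ext 1 = 1 := by
      ext i j
      refine Fin.cases ?_ (fun i => ?_) i <;> refine Fin.cases ?_ (fun j => ?_) j <;>
        simp [ext, Matrix.one_apply, Fin.succ_ne_zero, (Fin.succ_ne_zero _).symm]
    refine ⟨P * ext P', ext Q' * Q, ?_, ?_, ?_⟩
    · calc P * ext P' * (ext Q' * Q) = P * (ext P' * ext Q') * Q := by noncomm_ring
        _ = 1 := by rw [ext_mul, h1, ext_one, mul_one, hPQ]
    · calc ext Q' * Q * (P * ext P') = ext Q' * (Q * P) * ext P' := by noncomm_ring
        _ = 1 := by rw [hQP, mul_one, ext_mul, h2, ext_one]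
    · have : ext Q' * Q * A * (P * ext P') = ext Q' * M * ext P' := by rw [hM]; noncomm_ring
      rw [this]
      intro i j
      refine Fin.cases ?_ (fun i => ?_) i
      · intro h; exact absurd h (Fin.not_lt_zero _)
      · refine Fin.cases ?_ (fun j => ?_) j
        · intro _
          simp [ext, Matrix.mul_apply, Fin.sum_univ_succ, hcol]
        · intro h
          have := h3 i j (by simpa using h)
          simpa [ext, Matrix.mul_apply, Fin.sum_univ_succ, hcol] using this

theorem tri_small_aux (n : ℕ) (A : Matrix (Fin n) (Fin n) ℂ) :
    ∃ d : Fin n → ℂ, (∀ z ∈ spectrum ℂ A, ∃ i, d i = z) ∧ ∀ η > (0:ℝ),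
      ∃ P Q : Matrix (Fin n) (Fin n) ℂ, P * Q = 1 ∧ Q * P = 1 ∧
        ∀ i, ∑ j, ‖(Q * A * P - Matrix.diagonal d) i j‖ ≤ η := by
  obtain ⟨P, Q, hPQ, hQP, hT⟩ := tri_aux n A
  set T := Q * A * P with hTdef
  refine ⟨fun i => T i i, ?_, ?_⟩
  · intro z hz
    rw [Matrix.mem_spectrum_iff_isRoot_charpoly] at hz
    have hc : A.charpoly = T.charpoly := by
      have := Matrix.charpoly_mul_comm (Q * A) P
      rw [← hTdef, ← mul_assoc, hPQ, one_mul] at this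
      exact this.symm
    have hTt : T.BlockTriangular id := fun i j h => hT i j h
    rw [hc, Matrix.charpoly_of_upperTriangular T hTt, Polynomial.IsRoot,
      Polynomial.eval_prod, Finset.prod_eq_zero_iff] at hz
    obtain ⟨i, -, hi⟩ := hz
    refine ⟨i, ?_⟩
    simp at hi
    exact (sub_eq_zero.mp hi).symm
  · intro η hη
    set S : ℝ := ∑ i, ∑ j, ‖T i j‖ with hS
    have hS0 : 0 ≤ S := Finset.sum_nonneg fun i _ => Finset.sum_nonneg fun j _ => norm_nonneg _
    set t : ℝ := min 1 (η / (S + 1)) with ht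
    have ht0 : 0 < t := lt_min one_pos (by positivity)
    have ht1 : t ≤ 1 := min_le_left _ _
    have htS : t * S ≤ η := by
      have : t * (S + 1) ≤ η := by
        rw [← le_div_iff₀ (by positivity)]; exact min_le_right _ _
      nlinarith
    have htc : (t : ℂ) ≠ 0 := by exact_mod_cast ht0.ne'
    let D := Matrix.diagonal (fun i : Fin n => (t:ℂ) ^ (i:ℕ))
    let D' := Matrix.diagonal (fun i : Fin n => ((t:ℂ) ^ (i:ℕ))⁻¹)
    have hDD : D * D' = 1 := by
      simp only [D, D', Matrix.diagonal_mul_diagonal]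
      rw [← Matrix.diagonal_one]; congr 1; funext i; field_simp
    have hDD' : D' * D = 1 := by
      simp only [D, D', Matrix.diagonal_mul_diagonal]
      rw [← Matrix.diagonal_one]; congr 1; funext i; field_simp
    refine ⟨P * D, D' * Q, ?_, ?_, ?_⟩
    · calc P * D * (D' * Q) = P * (D * D') * Q := by noncomm_ring
        _ = 1 := by rw [hDD, mul_one, hPQ]
    · calc D' * Q * (P * D) = D' * (Q * P) * D := by noncomm_ring
        _ = 1 := by rw [hQP, mul_one, hDD']
    · intro i
      have e : D' * Q * A * (P * D) = D' * T * D := by rw [hTdef]; noncomm_ring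
      rw [e]
      have key : ∀ j, ‖(D' * T * D - Matrix.diagonal fun i => T i i) i j‖ ≤ t * ‖T i j‖ := by
        intro j
        simp only [D, D', Matrix.sub_apply, Matrix.mul_diagonal, Matrix.diagonal_mul]
        rcases lt_trichotomy i j with h | h | h
        · rw [Matrix.diagonal_apply_ne _ h.ne, sub_zero, norm_mul, norm_mul, norm_inv, norm_pow,
            norm_pow, Complex.norm_real, Real.norm_of_nonneg ht0.le]
          have h' : (i:ℕ) + 1 ≤ j := h
          have hp : t ^ (j:ℕ) ≤ t ^ ((i:ℕ) + 1) := pow_le_pow_of_le_one ht0.le ht1 h'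
          have hi : 0 < t ^ (i:ℕ) := pow_pos ht0 _
          calc (t ^ (i:ℕ))⁻¹ * ‖T i j‖ * t ^ (j:ℕ)
              ≤ (t ^ (i:ℕ))⁻¹ * ‖T i j‖ * t ^ ((i:ℕ) + 1) := by gcongr
            _ = t * ‖T i j‖ := by rw [pow_succ]; field_simp
        · subst h
          rw [Matrix.diagonal_apply_eq]
          have : ((t:ℂ) ^ (i:ℕ))⁻¹ * T i i * (t:ℂ) ^ (i:ℕ) - T i i = 0 := by
            field_simp; ring
          rw [this, norm_zero]; positivity
        · rw [Matrix.diagonal_apply_ne _ h.ne', hT i j h]; simp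
      calc _ ≤ ∑ j, t * ‖T i j‖ := Finset.sum_le_sum fun j _ => key j
        _ = t * ∑ j, ‖T i j‖ := by rw [Finset.mul_sum]
        _ ≤ t * S := by
          gcongr
          exact Finset.single_le_sum (f := fun i => ∑ j, ‖T i j‖)
            (fun i _ => Finset.sum_nonneg fun j _ => norm_nonneg _) (Finset.mem_univ i)
        _ ≤ η := htS

/-- One step of the cone argument. -/
theorem cone_step_aux {n : ℕ} (d : Fin n → ℂ) (ρ η : ℝ)
    (hgap : ∀ i, ‖d i‖ < ρ → ‖d i‖ + 2 * η ≤ ρ) (C : Matrix (Fin n) (Fin n) ℂ)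
    (hC : ∀ i, ∑ j, ‖(C - Matrix.diagonal d) i j‖ ≤ η) (x : Fin n → ℂ) (i : Fin n)
    (hi : ρ ≤ ‖d i‖) (hx : ∀ j, ‖x j‖ ≤ ‖x i‖) :
    ∃ i', ρ ≤ ‖d i'‖ ∧ (∀ j, ‖C.mulVec x j‖ ≤ ‖C.mulVec x i'‖) ∧
      (ρ - η) * ‖x i‖ ≤ ‖C.mulVec x i'‖ := by
  have err : ∀ j, ‖C.mulVec x j - d j * x j‖ ≤ η * ‖x i‖ := by
    intro j
    have : C.mulVec x j - d j * x j = ∑ l, (C - Matrix.diagonal d) j l * x l := by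
      have h := congrFun (Matrix.sub_mulVec C (Matrix.diagonal d) x) j
      rw [Pi.sub_apply, Matrix.mulVec_diagonal] at h
      rw [← h]; rfl
    rw [this]
    calc _ ≤ ∑ l, ‖(C - Matrix.diagonal d) j l * x l‖ := norm_sum_le _ _
      _ ≤ ∑ l, ‖(C - Matrix.diagonal d) j l‖ * ‖x i‖ := by
        refine Finset.sum_le_sum fun l _ => ?_
        rw [norm_mul]; gcongr; exact hx l
      _ = (∑ l, ‖(C - Matrix.diagonal d) j l‖) * ‖x i‖ := by rw [Finset.sum_mul]
      _ ≤ η * ‖x i‖ := by gcongr; exact hC j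
  have low : (ρ - η) * ‖x i‖ ≤ ‖C.mulVec x i‖ := by
    have h1 := err i
    have h2 := norm_sub_norm_le (d i * x i) (C.mulVec x i)
    rw [norm_sub_rev, norm_mul] at h2
    have := mul_le_mul_of_nonneg_right hi (norm_nonneg (x i))
    nlinarith
  obtain ⟨i', hi', hmax⟩ := Finset.exists_max_image (Finset.univ.filter fun j => ρ ≤ ‖d j‖)
    (fun j => ‖C.mulVec x j‖) ⟨i, by simpa using hi⟩
  have hl := low.trans (hmax i (by simpa using hi))
  refine ⟨i', by simpa using hi', ?_, hl⟩
  intro j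
  by_cases hj : ρ ≤ ‖d j‖
  · exact hmax j (by simpa using hj)
  · refine le_trans ?_ hl
    have h1 := err j
    have h2 := norm_sub_norm_le (C.mulVec x j) (d j * x j)
    rw [norm_mul] at h2
    have h3 := hgap j (not_le.mp hj)
    have h4 := mul_le_mul_of_nonneg_right h3 (norm_nonneg (x i))
    have h5 := mul_le_mul_of_nonneg_left (hx j) (norm_nonneg (d j))
    nlinarith

open scoped Matrix.Norms.L2Operator in
theorem main_aux (n : ℕ) (hn : 1 ≤ n)
    (A : Matrix (Fin n) (Fin n) ℂ) (ε : ℝ) (hε0 : 0 < ε)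
    (hε : ε < (spectralRadius ℂ A).toReal) :
    ∃ δ > (0:ℝ), ∀ L : List (Matrix (Fin n) (Fin n) ℂ), (∀ B ∈ L, ‖B - A‖ ≤ δ) →
      ((spectralRadius ℂ A).toReal - ε) ^ L.length ≤ ‖L.prod‖ := by
  haveI : Nonempty (Fin n) := ⟨⟨0, hn⟩⟩
  obtain ⟨z, hz, hzr⟩ := spectrum.exists_nnnorm_eq_spectralRadius A
  have hzρ : (spectralRadius ℂ A).toReal = ‖z‖ := by rw [← hzr]; simp
  rw [hzρ] at hε ⊢
  set ρ := ‖z‖ with hρ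
  obtain ⟨d, hd, hsmall⟩ := tri_small_aux n A
  obtain ⟨i0, hi0⟩ := hd z hz
  have : ∃ η : ℝ, 0 < η ∧ η ≤ ε ∧ ∀ i, ‖d i‖ < ρ → ‖d i‖ + 2 * η ≤ ρ := by
    have h1 : ∀ᶠ η : ℝ in nhdsWithin 0 (Set.Ioi 0), 0 < η := self_mem_nhdsWithin
    have h2 : ∀ᶠ η : ℝ in nhdsWithin 0 (Set.Ioi 0), η ≤ ε :=
      nhdsWithin_le_nhds (eventually_le_nhds hε0)
    have h3 : ∀ᶠ η : ℝ in nhdsWithin 0 (Set.Ioi 0), ∀ i, ‖d i‖ < ρ → ‖d i‖ + 2 * η ≤ ρ := by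
      rw [Filter.eventually_all]
      intro i
      by_cases h : ‖d i‖ < ρ
      · have : ∀ᶠ η : ℝ in nhdsWithin 0 (Set.Ioi 0), η ≤ (ρ - ‖d i‖) / 2 :=
          nhdsWithin_le_nhds (eventually_le_nhds (by linarith))
        filter_upwards [this] with η hη _
        linarith
      · exact Filter.Eventually.of_forall fun _ h' => absurd h' h
    obtain ⟨η, a, b, c⟩ := (h1.and (h2.and h3)).exists
    exact ⟨η, a, b, c⟩
  obtain ⟨η, hη0, hηε, hgap⟩ := this
  obtain ⟨P, Q, hPQ, hQP, hPQs⟩ := hsmall (η / 2) (by positivity)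
  set K := ‖Q‖ * ‖P‖ with hK
  have hK0 : 0 ≤ K := by positivity
  have hent : ∀ (X : Matrix (Fin n) (Fin n) ℂ) i j, ‖(Q * X * P) i j‖ ≤ K * ‖X‖ := by
    intro X i j
    calc _ ≤ ‖Q * X * P‖ := entry_le_norm_aux _ i j
      _ ≤ ‖Q * X‖ * ‖P‖ := norm_mul_le _ _
      _ ≤ ‖Q‖ * ‖X‖ * ‖P‖ := by gcongr; exact norm_mul_le _ _
      _ = K * ‖X‖ := by rw [hK]; ring
  refine ⟨η / (2 * (n * K + 1)), by positivity, ?_⟩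
  set δ := η / (2 * (n * K + 1)) with hδ
  have hδ0 : 0 < δ := by positivity
  have hδη : n * (K * δ) ≤ η / 2 := by
    have : δ * (n * K + 1) = η / 2 := by rw [hδ]; field_simp
    nlinarith
  have hrow : ∀ B : Matrix (Fin n) (Fin n) ℂ, ‖B - A‖ ≤ δ →
      ∀ i, ∑ j, ‖(Q * B * P - Matrix.diagonal d) i j‖ ≤ η := by
    intro B hB i
    have e : Q * B * P - Matrix.diagonal d
        = Q * (B - A) * P + (Q * A * P - Matrix.diagonal d) := by noncomm_ring
    rw [e]
    calc _ ≤ ∑ j, (K * δ + ‖(Q * A * P - Matrix.diagonal d) i j‖) := by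
          refine Finset.sum_le_sum fun j _ => ?_
          rw [Matrix.add_apply]
          refine (norm_add_le _ _).trans ?_
          gcongr
          exact (hent _ i j).trans (by gcongr)
      _ = n * (K * δ) + ∑ j, ‖(Q * A * P - Matrix.diagonal d) i j‖ := by
          rw [Finset.sum_add_distrib]; simp
      _ ≤ η := by linarith [hPQs i]
  have cone : ∀ L : List (Matrix (Fin n) (Fin n) ℂ), (∀ B ∈ L, ‖B - A‖ ≤ δ) →
      ∃ i, ρ ≤ ‖d i‖ ∧
        (∀ j, ‖(Q * L.prod * P).mulVec (Pi.single i0 1) j‖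
          ≤ ‖(Q * L.prod * P).mulVec (Pi.single i0 1) i‖) ∧
        (ρ - η) ^ L.length ≤ ‖(Q * L.prod * P).mulVec (Pi.single i0 1) i‖ := by
    intro L
    induction L with
    | nil =>
      intro _
      refine ⟨i0, by rw [hi0], ?_, ?_⟩
      · intro j
        rw [List.prod_nil, mul_one, hQP, Matrix.one_mulVec]
        by_cases h : j = i0
        · rw [h]
        · simp [h]
      · rw [List.prod_nil, mul_one, hQP, Matrix.one_mulVec]; simp
    | cons B L ih =>
      intro hL
      obtain ⟨i, a, b, c⟩ := ih fun B' h => hL B' (List.mem_cons_of_mem _ h)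
      obtain ⟨i', a', b', c'⟩ := cone_step_aux d ρ η hgap (Q * B * P)
        (hrow B (hL B List.mem_cons_self)) _ i a b
      have e : (Q * B * P) * (Q * L.prod * P) = Q * (B :: L).prod * P := by
        calc _ = Q * B * (P * Q) * L.prod * P := by noncomm_ring
          _ = _ := by rw [hPQ, mul_one, List.prod_cons]; noncomm_ring
      rw [Matrix.mulVec_mulVec, e] at b' c'
      refine ⟨i', a', b', le_trans ?_ c'⟩
      rw [List.length_cons, pow_succ, mul_comm]
      exact mul_le_mul_of_nonneg_left c (by linarith)
  have bound : ∀ L : List (Matrix (Fin n) (Fin n) ℂ), (∀ B ∈ L, ‖B - A‖ ≤ δ) →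
      (ρ - η) ^ L.length ≤ K * ‖L.prod‖ := by
    intro L hL
    obtain ⟨i, -, -, c⟩ := cone L hL
    refine c.trans ?_
    have := hent L.prod i i0
    simpa using this
  intro L hL
  have hle : (ρ - ε) ^ L.length ≤ (ρ - η) ^ L.length :=
    pow_le_pow_left₀ (by linarith) (by linarith) _
  refine hle.trans ?_
  by_contra hlt
  rw [not_le] at hlt
  set a := (ρ - η) ^ L.length with ha
  have ha0 : 0 < a := lt_of_le_of_lt (norm_nonneg _) hlt
  set b := ‖L.prod‖ with hb
  have hb0 : 0 ≤ b := norm_nonneg _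
  -- repeat the list many times
  have hN : ∀ N : ℕ, a ^ (N + 1) ≤ K * b ^ (N + 1) := by
    intro N
    have h := bound (List.replicate (N + 1) L).flatten (by
      intro B hB
      rw [List.mem_flatten] at hB
      obtain ⟨l, hl, hBl⟩ := hB
      rw [List.eq_of_mem_replicate hl] at hBl
      exact hL B hBl)
    have hp : (List.replicate (N + 1) L).flatten.prod = L.prod ^ (N + 1) := by
      rw [List.prod_flatten, List.map_replicate, List.prod_replicate]
    have hlen : (List.replicate (N + 1) L).flatten.length = L.length * (N + 1) := by
      simp [mul_comm]
    rw [hp, hlen, pow_mul] at h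
    refine h.trans ?_
    gcongr
    exact norm_pow_le' _ (Nat.succ_pos _)
  have hr : b / a < 1 := (div_lt_one ha0).mpr hlt
  have hlim := (tendsto_pow_atTop_nhds_zero_of_lt_one (by positivity : 0 ≤ b / a) hr).const_mul K
  rw [mul_zero] at hlim
  have hlim' := hlim.comp (Filter.tendsto_add_atTop_nat 1)
  obtain ⟨N, hNl⟩ := (hlim'.eventually (gt_mem_nhds one_pos)).exists
  simp only [Function.comp] at hNl
  have := hN N
  rw [div_pow, ← mul_div_assoc, div_lt_one (by positivity)] at hNl
  linarith

/-- Let `A` be an `n×n` complex matrix with spectral radius `ρ(A) > 0`.  For every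
`0 < ε < ρ(A)` there is `δ > 0` such that every finite product `B_k ⋯ B₁` of matrices
`δ`-close to `A` in operator norm satisfies `‖B_k ⋯ B₁‖ ≥ (ρ(A) − ε)^k`. -/
theorem product_lower_bound_near_matrix (n : ℕ) (hn : 1 ≤ n)
    (A : Matrix (Fin n) (Fin n) ℂ) (hρ : 0 < (spectralRadius ℂ A).toReal)
    (ε : ℝ) (hε0 : 0 < ε) (hε : ε < (spectralRadius ℂ A).toReal) :
    ∃ δ > (0:ℝ), ∀ k : ℕ, 1 ≤ k → ∀ B : Fin k → Matrix (Fin n) (Fin n) ℂ,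
      (∀ i, opNormC (B i - A) ≤ δ) →
      ((spectralRadius ℂ A).toReal - ε) ^ k ≤ opNormC ((List.ofFn B).reverse.prod) := by
  obtain ⟨δ, hδ, h⟩ := main_aux n hn A ε hε0 hε
  refine ⟨δ, hδ, fun k _ B hB => ?_⟩
  have := h (List.ofFn B).reverse (by
    intro X hX
    rw [List.mem_reverse, List.mem_ofFn] at hX
    obtain ⟨i, rfl⟩ := hX
    exact hB i)
  rw [List.length_reverse, List.length_ofFn] at this
  exact this
end

section
/- Let 𝕋 = {z ∈ ℂ : |z| = 1} with its normalized Haar probability measure. Let k : 𝕋 → [0,∞) be measurable with ∫ k = 1 and ∫ k² < ∞. Let f : 𝕋 → 𝕋 be the restriction to 𝕋 of a function holomorphic on a neighborhood of the closed unit disk (so that |f(z)| = 1 for all z ∈ 𝕋). For α ∈ 𝕋 define the operator L_α on bounded measurable functions φ : 𝕋 → ℝ by (L_α φ)(z) = ∫_{𝕋} k(α · z⁻¹ · f(y)) · φ(y) dy. Then for every integer m ≥ 0 and every z ∈ 𝕋, ∫_{𝕋} (L_α^m 1)(z) dα = 1, where 1 denotes the constant function with value 1 and the integral in α is with respect to the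 normalized Haar measure on 𝕋. -/
open MeasureTheory

noncomputable instance : MeasurableSpace Circle := borel _
instance : BorelSpace Circle := ⟨rfl⟩

/-- The operator `L_α` on functions on the circle:
`(L_α φ)(z) = ∫ k(α z⁻¹ f(y)) φ(y) dy`. -/
noncomputable def Lop (ν : Measure Circle) (k : Circle → ℝ) (f : Circle → Circle)
    (α : Circle) (φ : Circle → ℝ) : Circle → ℝ :=
  fun z => ∫ y, k (α * z⁻¹ * f y) * φ y ∂ν

open BoundedContinuousFunction

lemma cmv_mean (ν : Measure Circle) [IsProbabilityMeasure ν]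
    (hinv : ∀ g : Circle, Measure.map (fun z => g * z) ν = ν)
    (G : ℂ → ℂ) (hG : DifferentiableOn ℂ G (Metric.closedBall 0 1)) :
    ∫ y : Circle, G y ∂ν = G 0 := by
  have hGc : Continuous (fun y : Circle => G y) := by
    refine hG.continuousOn.comp_continuous (by fun_prop) (fun y => ?_)
    simp [Circle.norm_coe]
  have h1 : ∀ t : ℝ, ∫ y : Circle, G ((Circle.exp t * y : Circle) : ℂ) ∂ν = ∫ y : Circle, G y ∂ν := by
    intro t
    conv_rhs => rw [← hinv (Circle.exp t)]
    rw [integral_map (by fun_prop) hGc.aestronglyMeasurable]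
  have h2 : ∀ y : Circle, ∫ t in (0:ℝ)..2 * Real.pi, G ((Circle.exp t * y : Circle) : ℂ) =
      (2 * Real.pi : ℝ) • G 0 := by
    intro y
    have hd : DifferentiableOn ℂ (fun w : ℂ => G (w * y)) (Metric.closedBall 0 1) := by
      refine hG.comp (by fun_prop) (fun w hw => ?_)
      simpa [Circle.norm_coe] using hw
    have h := circleAverage_of_differentiable_on_off_countable (R := 1) (c := 0)
      (f := fun w : ℂ => G (w * y)) Set.countable_empty (by simpa using hd.continuousOn)
      (fun w hw => by
        have hw' : w ∈ Metric.ball (0:ℂ) 1 := by simpa using hw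
        exact (hd.mono Metric.ball_subset_closedBall).differentiableAt (Metric.isOpen_ball.mem_nhds hw'))
    rw [Real.circleAverage_def] at h
    simp only [zero_mul] at h
    rw [← h, smul_smul, mul_inv_cancel₀ (by positivity), one_smul]
    congr 1
    ext t
    simp [circleMap]
  have h3 : ∫ t in (0:ℝ)..2 * Real.pi, ∫ y : Circle, G ((Circle.exp t * y : Circle) : ℂ) ∂ν =
      ∫ y : Circle, (∫ t in (0:ℝ)..2 * Real.pi, G ((Circle.exp t * y : Circle) : ℂ)) ∂ν := by
    rw [intervalIntegral_integral_swap]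
    have hc : Continuous (Function.uncurry fun (t : ℝ) (y : Circle) => G ((Circle.exp t * y : Circle) : ℂ)) :=
      hGc.comp (by fun_prop : Continuous fun p : ℝ × Circle => Circle.exp p.1 * p.2)
    obtain ⟨C, hC⟩ := isCompact_univ.exists_bound_of_continuousOn (hGc.continuousOn (s := Set.univ))
    have : IsFiniteMeasure ((volume : Measure ℝ).restrict (Set.uIoc 0 (2 * Real.pi))) :=
      ⟨by simp [Set.uIoc]⟩
    refine Integrable.mono' (integrable_const C) hc.aestronglyMeasurable (ae_of_all _ fun p => hC _ trivial)
  simp only [h1, h2] at h3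
  simp only [intervalIntegral.integral_const, integral_const, probReal_univ, one_smul, sub_zero] at h3
  have hp : (2 * Real.pi : ℝ) ≠ 0 := by positivity
  exact smul_right_injective _ hp h3

/-- Characters on the torus. -/
noncomputable def tchar {m : ℕ} (n : Fin m → ℤ) (w : Fin m → Circle) : ℂ :=
  ((∏ i, w i ^ n i : Circle) : ℂ)

lemma tchar_cont {m : ℕ} (n : Fin m → ℤ) : Continuous (tchar n) := by
  unfold tchar
  fun_prop

lemma tchar_norm {m : ℕ} (n : Fin m → ℤ) (w) : ‖tchar n w‖ = 1 := by
  simp only [tchar, Circle.norm_coe]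

lemma fourier_coeff_van (ν : Measure Circle) [IsProbabilityMeasure ν]
    (hinv : ∀ g : Circle, Measure.map (fun z => g * z) ν = ν)
    (f : Circle → Circle)
    (hf : ∃ F : ℂ → ℂ, ∃ U : Set ℂ, IsOpen U ∧ Metric.closedBall (0:ℂ) 1 ⊆ U ∧
      DifferentiableOn ℂ F U ∧ ∀ z : Circle, F (z : ℂ) = ((f z : Circle) : ℂ))
    (a e : ℤ) (h : ∫ y, ((f y ^ a * (y ^ e)⁻¹ : Circle) : ℂ) ∂ν ≠ 0) :
    (0 ≤ a → 0 ≤ e) ∧ (a ≤ 0 → e ≤ 0) := by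
  obtain ⟨F, U, -, hU, hF, hFf⟩ := hf
  have key : ∀ (a p : ℕ), 0 < p → ∫ y, ((f y ^ a * y ^ p : Circle) : ℂ) ∂ν = 0 := by
    intro a p hp
    have := cmv_mean ν hinv (fun w => F w ^ a * w ^ p) (by
      have := hF.mono hU
      fun_prop)
    simpa [hFf, hp.ne'] using this
  constructor
  · intro ha
    by_contra he
    apply h
    obtain ⟨b, rfl⟩ := Int.eq_ofNat_of_zero_le ha
    obtain ⟨p, hp⟩ := Int.eq_ofNat_of_zero_le (a := -e) (by omega)
    rw [← key b p (by omega)]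
    congr 1
    ext y
    rw [← zpow_neg, hp, zpow_natCast, zpow_natCast]
  · intro ha
    by_contra he
    apply h
    obtain ⟨b, hb⟩ := Int.eq_ofNat_of_zero_le (a := -a) (by omega)
    obtain ⟨p, rfl⟩ := Int.eq_ofNat_of_zero_le (a := e) (by omega)
    rw [← star_star (∫ y, _ ∂ν), ← starRingEnd_apply, ← starRingEnd_apply, ← integral_conj]
    rw [show (0:ℂ) = (starRingEnd ℂ) 0 by simp, ← key b p (by omega)]
    congr 2
    ext y
    rw [← Circle.coe_inv_eq_conj, mul_inv, inv_inv, ← zpow_neg, hb, zpow_natCast, zpow_natCast]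

lemma f_meas (f : Circle → Circle)
    (hf : ∃ F : ℂ → ℂ, ∃ U : Set ℂ, IsOpen U ∧ Metric.closedBall (0:ℂ) 1 ⊆ U ∧
      DifferentiableOn ℂ F U ∧ ∀ z : Circle, F (z : ℂ) = ((f z : Circle) : ℂ)) : Measurable f := by
  obtain ⟨F, U, -, hU, hF, hFf⟩ := hf
  have : Continuous f := by
    have hind : Topology.IsInducing (fun z : Circle => (z : ℂ)) := ⟨rfl⟩
    rw [hind.continuous_iff]
    have : Continuous (fun z : Circle => F z) :=
      hF.continuousOn.comp_continuous (by fun_prop) (fun y => hU (by simp [Circle.norm_coe]))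
    exact this.congr hFf
  exact this.measurable

/-- The bounded continuous version. -/
noncomputable def bchar {m : ℕ} (n : Fin m → ℤ) : (Fin m → Circle) →ᵇ ℂ :=
  BoundedContinuousFunction.ofNormedAddCommGroup (tchar n) (tchar_cont n) 1
    (fun w => (tchar_norm n w).le)

lemma bchar_apply {m : ℕ} (n : Fin m → ℤ) (w) : bchar n w = tchar n w := rfl

lemma bchar_mul {m : ℕ} (n n' : Fin m → ℤ) : bchar n * bchar n' = bchar (n + n') := by
  ext w
  simp [bchar_apply, tchar, zpow_add, Finset.prod_mul_distrib]

lemma bchar_zero {m : ℕ} : bchar (0 : Fin m → ℤ) = 1 := by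
  ext w
  simp [bchar_apply, tchar]

lemma bchar_star {m : ℕ} (n : Fin m → ℤ) : star (bchar n) = bchar (-n) := by
  ext w
  rw [BoundedContinuousFunction.star_apply, bchar_apply, bchar_apply, tchar, tchar,
    ← starRingEnd_apply, ← Circle.coe_inv_eq_conj]
  simp

/-- trigonometric polynomials -/
noncomputable def trigAlg (m : ℕ) : StarSubalgebra ℂ ((Fin m → Circle) →ᵇ ℂ) where
  carrier := (Submodule.span ℂ (Set.range (bchar (m := m))) : Set _)
  mul_mem' := by
    intro a b ha hb
    have := Submodule.mul_mem_mul (R := ℂ) ha hb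
    rw [Submodule.span_mul_span] at this
    refine Submodule.span_mono ?_ this
    rintro _ ⟨_, ⟨n, rfl⟩, _, ⟨n', rfl⟩, rfl⟩
    exact ⟨n + n', (bchar_mul n n').symm⟩
  add_mem' := fun ha hb => Submodule.add_mem _ ha hb
  algebraMap_mem' := by
    intro r
    rw [Algebra.algebraMap_eq_smul_one, ← bchar_zero]
    exact Submodule.smul_mem _ _ (Submodule.subset_span ⟨0, rfl⟩)
  star_mem' := by
    intro a ha
    refine Submodule.span_induction (p := fun a _ => star a ∈ Submodule.span ℂ (Set.range (bchar (m := m)))) ?_ ?_ ?_ ?_ ha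
    · rintro _ ⟨n, rfl⟩
      exact Submodule.subset_span ⟨-n, (bchar_star n).symm⟩
    · simp
    · intro x y _ _ hx hy
      rw [star_add]; exact Submodule.add_mem _ hx hy
    · intro c x _ hx
      rw [star_smul]; exact Submodule.smul_mem _ _ hx

lemma mext {m : ℕ} (P P' : Measure (Fin m → Circle)) [IsFiniteMeasure P] [IsFiniteMeasure P']
    (h : ∀ n, ∫ w, tchar n w ∂P = ∫ w, tchar n w ∂P') : P = P' := by
  refine ext_of_forall_mem_subalgebra_integral_eq_of_pseudoEMetric_complete_countable
    (A := trigAlg m) ?_ ?_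
  · intro x y hxy
    obtain ⟨i, hi⟩ := Function.ne_iff.mp hxy
    refine ⟨_, ⟨toContinuousMapStarₐ ℂ (bchar (Pi.single i 1)), ⟨bchar (Pi.single i 1), Submodule.subset_span ⟨_, rfl⟩, rfl⟩, rfl⟩, ?_⟩
    change tchar _ x ≠ tchar _ y
    intro hh
    apply hi
    have hp : ∀ w : Fin m → Circle, ∏ j, w j ^ (Pi.single i 1 : Fin m → ℤ) j = w i := by
      intro w
      rw [Finset.prod_eq_single i] <;> simp +contextual
    simpa [tchar, ← Circle.coe_inj, hp] using hh
  · intro g hg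
    refine Submodule.span_induction (p := fun g _ => ∫ x, g x ∂P = ∫ x, g x ∂P') ?_ ?_ ?_ ?_ hg
    · rintro _ ⟨n, rfl⟩
      exact h n
    · simp
    · intro x y _ _ hx hy
      simp only [BoundedContinuousFunction.coe_add, Pi.add_apply]
      rw [integral_add (x.integrable _) (y.integrable _), integral_add (x.integrable _) (y.integrable _), hx, hy]
    · intro c x _ hx
      simp only [BoundedContinuousFunction.coe_smul]
      rw [integral_smul, integral_smul, hx]

/-- The arguments of the kernels. -/
noncomputable def Wmap (f : Circle → Circle) {m : ℕ} (α z : Circle) (y : Fin m → Circle) : Fin m → Circle :=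
  fun i => α * ((Fin.cons z y : Fin (m + 1) → Circle) i.castSucc)⁻¹ * f (y i)

lemma Wmap_cons (f : Circle → Circle) {m : ℕ} (α z y0 : Circle) (y : Fin m → Circle) :
    Wmap f α z (Fin.cons y0 y : Fin (m + 1) → Circle) =
      (Fin.cons (α * z⁻¹ * f y0) (Wmap f α y0 y) : Fin (m + 1) → Circle) := by
  ext i
  refine Fin.cases ?_ (fun j => ?_) i
  · simp [Wmap]
  · simp only [Wmap, Fin.cons_succ]
    rw [← Fin.succ_castSucc, Fin.cons_succ]

lemma meas_cons {m : ℕ} : Measurable (fun p : Circle × (Fin m → Circle) =>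
    (Fin.cons p.1 p.2 : Fin (m + 1) → Circle)) := by
  rw [measurable_pi_iff]
  intro i
  refine Fin.cases ?_ (fun j => ?_) i
  · simpa using measurable_fst
  · simp only [Fin.cons_succ]; fun_prop

lemma Wmap_meas (f : Circle → Circle) (hf : Measurable f) {m : ℕ} :
    Measurable (fun p : Circle × Circle × (Fin m → Circle) => Wmap f p.1 p.2.1 p.2.2) := by
  rw [measurable_pi_iff]
  intro i
  have h1 : Measurable (fun p : Circle × Circle × (Fin m → Circle) =>
      (Fin.cons p.2.1 p.2.2 : Fin (m + 1) → Circle) i.castSucc) :=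
    (measurable_pi_apply _).comp (meas_cons.comp measurable_snd)
  unfold Wmap
  fun_prop

lemma mp_cons (ν : Measure Circle) [IsProbabilityMeasure ν] (m : ℕ) :
    MeasurePreserving (fun p : Circle × (Fin m → Circle) =>
    (Fin.cons p.1 p.2 : Fin (m + 1) → Circle)) (ν.prod (Measure.pi fun _ => ν))
      (Measure.pi fun _ => ν) := by
  have h := (measurePreserving_piFinSuccAbove (fun _ : Fin (m+1) => ν) 0).symm
  convert! h using 1
  ext p i
  refine Fin.cases ?_ (fun j => ?_) i <;> simp [MeasurableEquiv.piFinSuccAbove_symm_apply, Fin.insertNthEquiv]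

lemma lint_cons (ν : Measure Circle) [IsProbabilityMeasure ν] (m : ℕ)
    (g : (Fin (m + 1) → Circle) → ENNReal) (hg : Measurable g) :
    ∫⁻ y, g y ∂(Measure.pi fun _ => ν) =
      ∫⁻ y0, ∫⁻ y, g (Fin.cons y0 y : Fin (m + 1) → Circle) ∂(Measure.pi fun _ => ν) ∂ν := by
  rw [← (mp_cons ν m).lintegral_comp hg, lintegral_prod]
  exact (hg.comp meas_cons).aemeasurable

lemma int_cons (ν : Measure Circle) [IsProbabilityMeasure ν] (m : ℕ)
    (g : (Fin (m + 1) → Circle) → ℂ) (hg : Measurable g) (hb : ∀ y, ‖g y‖ ≤ 1) :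
    ∫ y, g y ∂(Measure.pi fun _ => ν) =
      ∫ y0, ∫ y, g (Fin.cons y0 y : Fin (m + 1) → Circle) ∂(Measure.pi fun _ => ν) ∂ν := by
  conv_lhs => rw [← (mp_cons ν m).map_eq]
  rw [integral_map meas_cons.aemeasurable hg.aestronglyMeasurable, integral_prod]
  exact Integrable.mono' (integrable_const 1) (hg.comp meas_cons).aestronglyMeasurable
    (ae_of_all _ fun p => hb _)

lemma tchar_cons {m : ℕ} (n : Fin (m + 1) → ℤ) (w0 : Circle) (w : Fin m → Circle) :
    tchar n (Fin.cons w0 w : Fin (m + 1) → Circle) =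
      ((w0 ^ n 0 : Circle) : ℂ) * tchar (fun i => n i.succ) w := by
  simp [tchar, Fin.prod_univ_succ]

lemma char_rec (ν : Measure Circle) [IsProbabilityMeasure ν]
    (hinv : ∀ g : Circle, Measure.map (fun z => g * z) ν = ν)
    (f : Circle → Circle)
    (hf : ∃ F : ℂ → ℂ, ∃ U : Set ℂ, IsOpen U ∧ Metric.closedBall (0:ℂ) 1 ⊆ U ∧
      DifferentiableOn ℂ F U ∧ ∀ z : Circle, F (z : ℂ) = ((f z : Circle) : ℂ))
    (m : ℕ) : ∀ (n : Fin m → ℤ), ∃ (C : ℂ) (e : ℤ),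
      (∀ α z : Circle, ∫ y, tchar n (Wmap f α z y) ∂(Measure.pi fun _ => ν) =
        C * ((α ^ (∑ i, n i) * (z ^ e)⁻¹ : Circle) : ℂ)) ∧
      (C ≠ 0 → (e = 0 → ∀ i, n i = 0) ∧ ((0 ≤ e ∧ ∀ i, 0 ≤ n i) ∨ (e ≤ 0 ∧ ∀ i, n i ≤ 0))) := by
  have hfm := f_meas f hf
  induction m with
  | zero =>
    intro n
    refine ⟨1, 0, ?_, ?_⟩
    · intro α z
      simp [tchar]
    · intro _
      exact ⟨fun _ i => i.elim0, Or.inl ⟨le_rfl, fun i => i.elim0⟩⟩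
  | succ m ih =>
    intro n
    obtain ⟨C, e, h1, h2⟩ := ih (fun i => n i.succ)
    refine ⟨C * ∫ y, ((f y ^ n 0 * (y ^ e)⁻¹ : Circle) : ℂ) ∂ν, n 0, ?_, ?_⟩
    · intro α z
      rw [int_cons]
      · simp only [Wmap_cons, tchar_cons]
        simp only [integral_const_mul, h1]
        rw [mul_assoc, ← integral_mul_const, ← integral_const_mul]
        congr 1
        ext y
        rw [Fin.sum_univ_succ, zpow_add, mul_zpow, mul_zpow]
        push_cast
        simp only [inv_zpow]
        ring
      · exact (tchar_cont n).measurable.comp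
          ((Wmap_meas f hfm).comp (by fun_prop : Measurable fun y : Fin (m+1) → Circle => (α, z, y)))
      · intro y
        exact (tchar_norm _ _).le
    · intro hC
      obtain ⟨hC1, hI⟩ := mul_ne_zero_iff.mp hC
      obtain ⟨ha, hb⟩ := fourier_coeff_van ν hinv f hf _ _ hI
      obtain ⟨h3, h4⟩ := h2 hC1
      refine ⟨fun h0 => ?_, ?_⟩
      · have he : e = 0 := le_antisymm (hb h0.le) (ha h0.ge)
        exact Fin.cases h0 (h3 he)
      · by_cases he : e = 0
        · rcases le_total 0 (n 0) with h | h
          · exact Or.inl ⟨h, Fin.cases h fun i => (h3 he i).ge⟩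
          · exact Or.inr ⟨h, Fin.cases h fun i => (h3 he i).le⟩
        · rcases h4 with ⟨h5, h6⟩ | ⟨h5, h6⟩
          · have h : 0 ≤ n 0 := by
              by_contra hn
              have := hb (by omega)
              omega
            exact Or.inl ⟨h, Fin.cases h h6⟩
          · have h : n 0 ≤ 0 := by
              by_contra hn
              have := ha (by omega)
              omega
            exact Or.inr ⟨h, Fin.cases h h6⟩

lemma int_zpow (ν : Measure Circle) [IsProbabilityMeasure ν]
    (hinv : ∀ g : Circle, Measure.map (fun z => g * z) ν = ν) (n : ℤ) (hn : n ≠ 0) :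
    ∫ y, ((y ^ n : Circle) : ℂ) ∂ν = 0 := by
  by_contra h
  have := fourier_coeff_van ν hinv (fun _ => 1)
    ⟨fun _ => 1, Set.univ, isOpen_univ, Set.subset_univ _, by fun_prop, by simp⟩ 0 (-n) (by
      simpa using h)
  have h1 := this.1 le_rfl
  have h2 := this.2 le_rfl
  omega

set_option maxHeartbeats 1000000 in
lemma law_eq (ν : Measure Circle) [IsProbabilityMeasure ν]
    (hinv : ∀ g : Circle, Measure.map (fun z => g * z) ν = ν)
    (f : Circle → Circle)
    (hf : ∃ F : ℂ → ℂ, ∃ U : Set ℂ, IsOpen U ∧ Metric.closedBall (0:ℂ) 1 ⊆ U ∧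
      DifferentiableOn ℂ F U ∧ ∀ z : Circle, F (z : ℂ) = ((f z : Circle) : ℂ))
    (m : ℕ) (z : Circle) :
    Measure.map (fun p : Circle × (Fin m → Circle) => Wmap f p.1 z p.2)
      (ν.prod (Measure.pi fun _ => ν)) = Measure.pi fun _ => ν := by
  have hfm := f_meas f hf
  have hW : Measurable (fun p : Circle × (Fin m → Circle) => Wmap f p.1 z p.2) :=
    (Wmap_meas f hfm).comp (by fun_prop : Measurable fun p : Circle × (Fin m → Circle) => (p.1, z, p.2))
  have := Measure.isProbabilityMeasure_map (μ := ν.prod (Measure.pi fun _ : Fin m => ν)) hW.aemeasurable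
  apply mext
  intro n
  by_cases hn : ∀ i, n i = 0
  · have : tchar n = fun _ => 1 := by
      ext w
      simp [tchar, hn]
    simp [this]
  have hR : ∫ w, tchar n w ∂(Measure.pi fun _ => ν) = 0 := by
    have : tchar n = fun w => ∏ i, ((w i ^ n i : Circle) : ℂ) := by
      ext w
      exact map_prod Circle.coeHom _ _
    rw [this, integral_fintype_prod_eq_prod (f := fun i w => ((w ^ n i : Circle) : ℂ))]
    push Not at hn
    obtain ⟨i, hi⟩ := hn
    exact Finset.prod_eq_zero (Finset.mem_univ i) (int_zpow ν hinv _ hi)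
  rw [hR, integral_map hW.aemeasurable (tchar_cont n).aestronglyMeasurable, integral_prod]
  swap
  · exact Integrable.mono' (integrable_const 1) ((tchar_cont n).measurable.comp hW).aestronglyMeasurable
      (ae_of_all _ fun p => (tchar_norm _ _).le)
  obtain ⟨C, e, h1, h2⟩ := char_rec ν hinv f hf m n
  simp only [h1]
  by_cases hC : C = 0
  · simp [hC]
  have hs : ∑ i, n i ≠ 0 := by
    intro hs
    apply hn
    rcases (h2 hC).2 with ⟨-, h⟩ | ⟨-, h⟩
    · intro i
      exact (Finset.sum_eq_zero_iff_of_nonneg (fun i _ => h i)).mp hs i (Finset.mem_univ i)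
    · intro i
      exact (Finset.sum_eq_zero_iff_of_nonpos (fun i _ => h i)).mp hs i (Finset.mem_univ i)
  simp only [Circle.coe_mul]
  rw [integral_const_mul, integral_mul_const, int_zpow ν hinv _ hs]
  simp

/-- extended-real version of the iterates -/
noncomputable def Jit (ν : Measure Circle) (k : Circle → ENNReal) (f : Circle → Circle) :
    ℕ → Circle → Circle → ENNReal
  | 0, _, _ => 1
  | m + 1, α, z => ∫⁻ y, k (α * z⁻¹ * f y) * Jit ν k f m α y ∂ν

lemma Jit_meas (ν : Measure Circle) [IsProbabilityMeasure ν] (k : Circle → ENNReal) (hk : Measurable k)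
    (f : Circle → Circle) (hf : Measurable f) (m : ℕ) :
    Measurable (fun p : Circle × Circle => Jit ν k f m p.1 p.2) := by
  induction m with
  | zero => exact measurable_const
  | succ m ih =>
    simp only [Jit]
    refine Measurable.lintegral_prod_right' (f := fun q : (Circle × Circle) × Circle =>
      k (q.1.1 * q.1.2⁻¹ * f q.2) * Jit ν k f m q.1.1 q.2) ?_
    refine Measurable.mul (by fun_prop) ?_
    exact ih.comp (by fun_prop : Measurable fun q : (Circle × Circle) × Circle => (q.1.1, q.2))

lemma Jit_eq (ν : Measure Circle) [IsProbabilityMeasure ν] (k : Circle → ENNReal) (hk : Measurable k)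
    (f : Circle → Circle) (hf : Measurable f) (m : ℕ) : ∀ α z,
    Jit ν k f m α z = ∫⁻ y, ∏ i, k (Wmap f α z y i) ∂(Measure.pi fun _ : Fin m => ν) := by
  have hm : ∀ (m : ℕ) α z, Measurable fun y : Fin m → Circle => ∏ i, k (Wmap f α z y i) := by
    intro m α z
    have h : Measurable fun y : Fin m → Circle => Wmap f α z y :=
      (Wmap_meas f hf).comp (by fun_prop : Measurable fun y : Fin m → Circle => (α, z, y))
    refine Finset.measurable_fun_prod _ fun i _ => hk.comp ((measurable_pi_apply i).comp h)
  induction m with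
  | zero => intro α z; simp [Jit]
  | succ m ih =>
    intro α z
    rw [lint_cons ν m _ (hm _ α z)]
    simp only [Jit, ih, Wmap_cons, Fin.prod_univ_succ, Fin.cons_zero, Fin.cons_succ]
    congr 1
    ext y0
    rw [lintegral_const_mul _ (hm m α y0)]

lemma Jit_avg (ν : Measure Circle) [IsProbabilityMeasure ν]
    (hinv : ∀ g : Circle, Measure.map (fun z => g * z) ν = ν)
    (k : Circle → ENNReal) (hk : Measurable k) (hk1 : ∫⁻ w, k w ∂ν = 1)
    (f : Circle → Circle)
    (hf : ∃ F : ℂ → ℂ, ∃ U : Set ℂ, IsOpen U ∧ Metric.closedBall (0:ℂ) 1 ⊆ U ∧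
      DifferentiableOn ℂ F U ∧ ∀ z : Circle, F (z : ℂ) = ((f z : Circle) : ℂ))
    (m : ℕ) (z : Circle) :
    ∫⁻ α, Jit ν k f m α z ∂ν = 1 := by
  have hfm := f_meas f hf
  have hW : Measurable (fun p : Circle × (Fin m → Circle) => Wmap f p.1 z p.2) :=
    (Wmap_meas f hfm).comp (by fun_prop : Measurable fun p : Circle × (Fin m → Circle) => (p.1, z, p.2))
  have hK : Measurable (fun w : Fin m → Circle => ∏ i, k (w i)) := by fun_prop
  simp only [Jit_eq ν k hk f hfm]
  rw [← lintegral_prod (fun p : Circle × (Fin m → Circle) => ∏ i, k (Wmap f p.1 z p.2 i))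
    (hK.comp hW).aemeasurable]
  rw [← lintegral_map hK hW, law_eq ν hinv f hf m z]
  rw [ProbabilityTheory.lintegral_prod_eq_prod_lintegral_of_indepFun Finset.univ
    (fun i (w : Fin m → Circle) => k (w i))
    (ProbabilityTheory.iIndepFun_pi (X := fun _ => k) (fun _ => hk.aemeasurable)) (by fun_prop)]
  refine Finset.prod_eq_one fun i _ => ?_
  rw [(measurePreserving_eval (fun _ : Fin m => ν) i).lintegral_comp hk, hk1]

lemma Lop_eq (ν : Measure Circle) [IsProbabilityMeasure ν]
    (k : Circle → ℝ) (hk0 : ∀ z, 0 ≤ k z) (hk : Measurable k)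
    (f : Circle → Circle) (hf : Measurable f) (α : Circle) (m : ℕ) : ∀ z,
    Jit ν (fun w => ENNReal.ofReal (k w)) f m α z < ⊤ →
    (Lop ν k f α)^[m] (fun _ => 1) z = (Jit ν (fun w => ENNReal.ofReal (k w)) f m α z).toReal := by
  induction m with
  | zero => intro z _; simp [Jit]
  | succ m ih =>
    intro z hz
    rw [Function.iterate_succ_apply', Lop]
    simp only [Jit] at hz ⊢
    have hm : Measurable fun y => ENNReal.ofReal (k (α * z⁻¹ * f y)) *
        Jit ν (fun w => ENNReal.ofReal (k w)) f m α y := by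
      refine Measurable.mul (by fun_prop) ?_
      exact (Jit_meas ν _ (by fun_prop) f hf m).comp (by fun_prop : Measurable fun y : Circle => (α, y))
    have hae := ae_lt_top hm hz.ne
    rw [← integral_toReal hm.aemeasurable hae]
    apply integral_congr_ae
    filter_upwards [hae] with y hy
    rw [ENNReal.toReal_mul, ENNReal.toReal_ofReal (hk0 _)]
    by_cases h0 : k (α * z⁻¹ * f y) = 0
    · simp [h0]
    · rw [ih y]
      by_contra htop
      rw [not_lt, top_le_iff] at htop
      rw [htop, ENNReal.mul_top] at hy
      · exact lt_irrefl _ hy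
      · have := hk0 (α * z⁻¹ * f y)
        simpa using lt_of_le_of_ne this (Ne.symm h0)

/-- Let `𝕋` be the circle group with its normalized Haar probability measure `ν`
(characterized as the unique translation-invariant Borel probability measure).
Let `k : 𝕋 → [0,∞)` be measurable with `∫ k = 1` and `∫ k² < ∞`, and let `f : 𝕋 → 𝕋` be
the restriction of a function holomorphic on a neighborhood of the closed unit disk.
Then for every `m ≥ 0` and every `z ∈ 𝕋`, `∫ (L_α^m 1)(z) dα = 1`. -/
theorem circle_operator_average_one
    (ν : Measure Circle) [IsProbabilityMeasure ν]
    (hinv : ∀ g : Circle, Measure.map (fun z => g * z) ν = ν)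
    (k : Circle → ℝ) (hk0 : ∀ z, 0 ≤ k z) (hkmeas : Measurable k)
    (hk1 : ∫ z, k z ∂ν = 1) (hk2 : Integrable (fun z => (k z) ^ 2) ν)
    (f : Circle → Circle)
    (hf : ∃ F : ℂ → ℂ, ∃ U : Set ℂ, IsOpen U ∧ Metric.closedBall (0:ℂ) 1 ⊆ U ∧
      DifferentiableOn ℂ F U ∧ ∀ z : Circle, F (z : ℂ) = ((f z : Circle) : ℂ))
    (m : ℕ) (z : Circle) :
    ∫ α, (Lop ν k f α)^[m] (fun _ => 1) z ∂ν = 1 := by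
  have hfm := f_meas f hf
  have hkm : Measurable fun w => ENNReal.ofReal (k w) := by fun_prop
  have hki : Integrable k ν := by
    by_contra h
    rw [integral_undef h] at hk1
    exact zero_ne_one hk1
  have hl : ∫⁻ w, ENNReal.ofReal (k w) ∂ν = 1 := by
    rw [← ofReal_integral_eq_lintegral_ofReal hki (ae_of_all _ hk0), hk1, ENNReal.ofReal_one]
  have havg := Jit_avg ν hinv _ hkm hl f hf m z
  have hJ : Measurable fun α => Jit ν (fun w => ENNReal.ofReal (k w)) f m α z :=
    (Jit_meas ν _ hkm f hfm m).comp (by fun_prop : Measurable fun α : Circle => (α, z))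
  have hae := ae_lt_top hJ (by rw [havg]; exact ENNReal.one_ne_top)
  have : ∫ α, (Lop ν k f α)^[m] (fun _ => 1) z ∂ν =
      ∫ α, (Jit ν (fun w => ENNReal.ofReal (k w)) f m α z).toReal ∂ν := by
    apply integral_congr_ae
    filter_upwards [hae] with α hα
    exact Lop_eq ν k hk0 hkmeas f hfm α m z hα
  rw [this, integral_toReal hJ.aemeasurable hae, havg, ENNReal.toReal_one]
end
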